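/- arXiv:2510.10882 — 5 statements merged into one kernel-verified Lean document; each statement's English description precedes it below -/
import Mathlib

section
/- Let X be a normal topological space and n ∈ ℕ. Then X has covering dimension at most n if and only if for every continuous map f : X → ℝ^{n+1} and every ε > 0 there is a continuous map g : X → ℝ^{n+1} such that g(x) ≠ 0 for all x ∈ X and ‖f(x) − g(x)‖ ≤ ε for all x ∈ X. -/
/-- A topological space `X` has covering dimension at most `n` if every finite open cover of
`X` admits a finite open refinement covering `X` in which every point lies in at most `n + 1`
of the sets. -/
def CovDimLE (X : Type*) [TopologicalSpace X] (n : ℕ) : Prop :=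
  ∀ (ι : Type) (_ : Finite ι) (U : ι → Set X), (∀ i, IsOpen (U i)) → (⋃ i, U i) = Set.univ →
    ∃ (κ : Type) (_ : Finite κ) (V : κ → Set X),
      (∀ j, IsOpen (V j)) ∧ (⋃ j, V j) = Set.univ ∧
      (∀ j, ∃ i, V j ⊆ U i) ∧
      (∀ x : X, Set.ncard {j | x ∈ V j} ≤ n + 1)

open Set Metric MeasureTheory in
/-- Finitely many points of a finite-dimensional normed space can be moved by at most `δ` so that
any `finrank ℝ E` of them become linearly independent. -/
theorem exists_linearIndepOn_of_card_le_finrank {E κ : Type*} [NormedAddCommGroup E]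
    [NormedSpace ℝ E] [FiniteDimensional ℝ E] [Fintype κ] (c : κ → E) {δ : ℝ} (hδ : 0 < δ) :
    ∃ p : κ → E, (∀ j, ‖c j - p j‖ ≤ δ) ∧
      ∀ s : Finset κ, s.card ≤ Module.finrank ℝ E → LinearIndepOn ℝ p (s : Set κ) := by
  classical
  suffices H : ∀ T : Finset κ, ∃ p : κ → E, (∀ j, ‖c j - p j‖ ≤ δ) ∧
      ∀ s ⊆ T, s.card ≤ Module.finrank ℝ E → LinearIndepOn ℝ p (s : Set κ) by
    obtain ⟨p, hp, hs⟩ := H Finset.univ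
    exact ⟨p, hp, fun s => hs s (Finset.subset_univ s)⟩
  intro T
  induction T using Finset.induction_on with
  | empty =>
    refine ⟨c, fun j => by simpa using hδ.le, fun s hs _ => ?_⟩
    rw [Finset.subset_empty.1 hs, Finset.coe_empty]
    exact linearIndepOn_empty ℝ c
  | insert a T haT ih =>
    obtain ⟨p, hp, hT⟩ := ih
    let _ : MeasurableSpace E := borel E
    have : BorelSpace E := ⟨rfl⟩
    set I := T.powerset.filter (fun s => s.card < Module.finrank ℝ E)
    have hnull : (Measure.addHaar : Measure E)
        (⋃ s ∈ I, (Submodule.span ℝ (p '' (s : Set κ)) : Set E)) = 0 := by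
      refine (measure_biUnion_null_iff I.countable_toSet).2 fun s hs => ?_
      refine Measure.addHaar_submodule _ _ fun htop => ?_
      have hcard : s.card < Module.finrank ℝ E := (Finset.mem_filter.1 hs).2
      have hle : Module.finrank ℝ (Submodule.span ℝ ((s.image p : Finset E) : Set E)) ≤ _ :=
        finrank_span_finset_le_card (R := ℝ) (s.image p)
      rw [Finset.coe_image, htop, finrank_top] at hle
      exact absurd (hle.trans Finset.card_image_le) (not_le.2 hcard)
    obtain ⟨v, hvb, hv⟩ : ∃ v ∈ ball (c a) δ,
        v ∉ ⋃ s ∈ I, (Submodule.span ℝ (p '' (s : Set κ)) : Set E) := by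
      by_contra! hsub
      exact (measure_ball_pos Measure.addHaar (c a) hδ).ne' (measure_mono_null hsub hnull)
    have heq : ∀ s : Finset κ, a ∉ s → EqOn p (Function.update p a v) (s : Set κ) := by
      intro s has j hj
      rw [Function.update_of_ne]
      rintro rfl
      exact has hj
    refine ⟨Function.update p a v, fun j => ?_, fun s hs hcard => ?_⟩
    · rcases eq_or_ne j a with rfl | hj
      · rw [Function.update_self, ← dist_eq_norm, dist_comm]
        exact (mem_ball.1 hvb).le
      · rw [Function.update_of_ne hj]
        exact hp j
    · by_cases has : a ∈ s
      · obtain ⟨r, har, rfl⟩ : ∃ r, a ∉ r ∧ insert a r = s :=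
          ⟨s.erase a, Finset.notMem_erase a s, Finset.insert_erase has⟩
        have hrT : r ⊆ T := (Finset.insert_subset_insert_iff har).1 hs
        rw [Finset.card_insert_of_notMem har] at hcard
        rw [Finset.coe_insert, linearIndepOn_insert (by simpa using har),
          ← linearIndepOn_congr (heq r har), ← (heq r har).image_eq, Function.update_self]
        refine ⟨hT r hrT (by omega), fun hmem => hv ?_⟩
        exact mem_biUnion (x := r)
          (Finset.mem_filter.2 ⟨Finset.mem_powerset.2 hrT, by omega⟩) hmem
      · rw [← linearIndepOn_congr (heq s has)]
        exact hT s ((Finset.subset_insert_iff_of_notMem has).1 hs) hcard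

/-- A finite open cover of a normal space has a subordinate partition of unity. -/
theorem exists_continuous_sum_eq_one_of_open_cover {X κ : Type*} [TopologicalSpace X]
    [NormalSpace X] [Fintype κ] {V : κ → Set X} (hV : ∀ j, IsOpen (V j))
    (hcov : ⋃ j, V j = Set.univ) :
    ∃ φ : κ → X → ℝ, (∀ j, Continuous (φ j)) ∧ (∀ j x, 0 ≤ φ j x) ∧ (∀ x, ∑ j, φ j x = 1) ∧
      ∀ j x, φ j x ≠ 0 → x ∈ V j := by
  obtain ⟨φ, hφ⟩ := PartitionOfUnity.exists_isSubordinate_of_locallyFinite isClosed_univ V hV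
    (locallyFinite_of_finite V) hcov.ge
  refine ⟨fun j => φ j, fun j => (φ j).continuous, φ.nonneg, fun x => ?_,
    fun j x hx => hφ j (subset_tsupport _ hx)⟩
  rw [← finsum_eq_sum_of_fintype]
  exact φ.sum_eq_one (Set.mem_univ x)

/-- On a normal space of covering dimension at most `n`, bounded maps into an
`(n + 1)`-dimensional space can be approximated by maps without zeros. -/
theorem CovDimLE.exists_ne_zero_of_bounded {X E : Type*} [TopologicalSpace X] [NormalSpace X]
    {n : ℕ} (h : CovDimLE X n) [NormedAddCommGroup E] [NormedSpace ℝ E] [FiniteDimensional ℝ E]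
    (hE : n + 1 ≤ Module.finrank ℝ E) {f : X → E} (hf : Continuous f) {R : ℝ}
    (hR : ∀ x, ‖f x‖ ≤ R) {ε : ℝ} (hε : 0 < ε) :
    ∃ g : X → E, Continuous g ∧ (∀ x, g x ≠ 0) ∧ ∀ x, ‖f x - g x‖ ≤ ε := by
  classical
  obtain ⟨t, -, ht, hcov⟩ :=
    finite_cover_balls_of_compact (isCompact_closedBall (0 : E) R) (half_pos hε)
  have := ht.to_subtype
  obtain ⟨m, ⟨e⟩⟩ := Finite.exists_equiv_fin t
  obtain ⟨κ, _, V, hVo, hVc, hVU, hVn⟩ := h (Fin m) inferInstance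
    (fun i => f ⁻¹' Metric.ball (e.symm i : E) (ε / 2))
    (fun i => Metric.isOpen_ball.preimage hf) (by
      refine Set.eq_univ_of_forall fun x => ?_
      obtain ⟨y, hy, hxy⟩ := Set.mem_iUnion₂.1 (hcov (mem_closedBall_zero_iff.2 (hR x)))
      exact Set.mem_iUnion.2 ⟨e ⟨y, hy⟩, by simpa using hxy⟩)
  have := Fintype.ofFinite κ
  choose i hi using hVU
  obtain ⟨φ, hφc, hφ0, hφ1, hφV⟩ := exists_continuous_sum_eq_one_of_open_cover hVo hVc
  obtain ⟨p, hp, hind⟩ :=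
    exists_linearIndepOn_of_card_le_finrank (fun j => (e.symm (i j) : E)) (half_pos hε)
  refine ⟨fun x => ∑ j, φ j x • p j,
    continuous_finsetSum _ fun j _ => (hφc j).smul continuous_const, fun x hx => ?_, fun x => ?_⟩
  · set s : Finset κ := Finset.univ.filter fun j => φ j x ≠ 0 with hs
    have hcard : s.card ≤ Module.finrank ℝ E := by
      refine le_trans ?_ ((hVn x).trans hE)
      rw [← Set.ncard_coe_finset]
      exact Set.ncard_le_ncard (fun j hj => hφV j x (Finset.mem_filter.1 hj).2)
        (Set.toFinite _)
    have hsum : ∑ j ∈ s, φ j x • p j = 0 := by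
      rw [← hx]
      refine Finset.sum_subset (Finset.subset_univ s) fun j _ hj => ?_
      rw [show φ j x = 0 by simpa [hs] using hj, zero_smul]
    have hzero : ∀ j ∈ s, φ j x = 0 :=
      linearIndepOn_finset_iff.1 (hind s hcard) (fun j => φ j x) hsum
    have hall : ∀ j, φ j x = 0 := fun j => by
      by_contra hj
      exact hj (hzero j (by simpa [hs] using hj))
    simpa [hall] using hφ1 x
  · have hdiff : f x - ∑ j, φ j x • p j = ∑ j, φ j x • (f x - p j) := by
      simp only [smul_sub, Finset.sum_sub_distrib, ← Finset.sum_smul, hφ1, one_smul]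
    rw [hdiff]
    calc ‖∑ j, φ j x • (f x - p j)‖ ≤ ∑ j, φ j x * ε := by
          refine norm_sum_le_of_le _ fun j _ => ?_
          rw [norm_smul, Real.norm_of_nonneg (hφ0 j x)]
          by_cases hj : φ j x = 0
          · simp [hj]
          · refine mul_le_mul_of_nonneg_left ?_ (hφ0 j x)
            have h1 : ‖f x - e.symm (i j)‖ < ε / 2 :=
              mem_ball_iff_norm.1 (hi j (hφV j x hj))
            have h2 := norm_sub_le_norm_sub_add_norm_sub (f x) (e.symm (i j) : E) (p j)
            linarith [hp j]
      _ = ε := by rw [← Finset.sum_mul, hφ1, one_mul]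

/-- On a normal space of covering dimension at most `n`, maps into an `(n + 1)`-dimensional space
can be approximated by maps without zeros. -/
theorem CovDimLE.exists_ne_zero {X E : Type*} [TopologicalSpace X] [NormalSpace X]
    {n : ℕ} (h : CovDimLE X n) [NormedAddCommGroup E] [NormedSpace ℝ E] [FiniteDimensional ℝ E]
    (hE : n + 1 ≤ Module.finrank ℝ E) {f : X → E} (hf : Continuous f) {ε : ℝ} (hε : 0 < ε) :
    ∃ g : X → E, Continuous g ∧ (∀ x, g x ≠ 0) ∧ ∀ x, ‖f x - g x‖ ≤ ε := by
  have hpos : ∀ x, 0 < max ε ‖f x‖ := fun x => lt_max_of_lt_left hε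
  set f' : X → E := fun x => (ε / max ε ‖f x‖) • f x with hf'
  have hf'c : Continuous f' :=
    (continuous_const.div (continuous_const.max hf.norm) fun x => (hpos x).ne').smul hf
  have hbd : ∀ x, ‖f' x‖ ≤ ε := fun x => by
    rw [hf', norm_smul, Real.norm_of_nonneg (div_nonneg hε.le (hpos x).le), div_mul_eq_mul_div,
      div_le_iff₀ (hpos x)]
    exact mul_le_mul_of_nonneg_left (le_max_right _ _) hε.le
  obtain ⟨g, hg, hg0, hfg⟩ := h.exists_ne_zero_of_bounded hE hf'c hbd (half_pos hε)
  refine ⟨fun x => g x + (f x - f' x), hg.add (hf.sub hf'c), fun x hx => ?_, fun x => ?_⟩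
  · beta_reduce at hx
    rcases le_or_gt ‖f x‖ ε with hx' | hx'
    · have : f' x = f x := by simp [hf', max_eq_left hx', hε.ne']
      exact hg0 x (by simpa [this] using hx)
    · have heq : f x = f' x - g x := by
        rw [← sub_eq_zero, ← hx]
        abel
      have hle := hfg x
      rw [← heq] at hle
      linarith
  · rw [show f x - (g x + (f x - f' x)) = f' x - g x by abel]
    linarith [hfg x]

/-- The approximation property for maps into `ℝ^{n+1}`. -/
def ApproxNeZero (X : Type*) [TopologicalSpace X] (n : ℕ) : Prop :=
  ∀ f : X → EuclideanSpace ℝ (Fin (n + 1)), Continuous f → ∀ ε > (0 : ℝ),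
    ∃ g : X → EuclideanSpace ℝ (Fin (n + 1)), Continuous g ∧ (∀ x, g x ≠ 0) ∧
      ∀ x, ‖f x - g x‖ ≤ ε

/-- A zero-free approximation can be chosen equal to the given map where the latter is large. -/
theorem ApproxNeZero.exists_eq_of_le {X : Type*} [TopologicalSpace X] {n : ℕ}
    (h : ApproxNeZero X n) {f : X → EuclideanSpace ℝ (Fin (n + 1))} (hf : Continuous f)
    {δ : ℝ} (hδ : 0 < δ) :
    ∃ g : X → EuclideanSpace ℝ (Fin (n + 1)), Continuous g ∧ (∀ x, g x ≠ 0) ∧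
      ∀ x, δ ≤ ‖f x‖ → g x = f x := by
  obtain ⟨g, hg, hg0, hfg⟩ := h f hf (δ / 2) (half_pos hδ)
  set l : X → ℝ := fun x => max 0 (min 1 (2 - 2 * ‖f x‖ / δ)) with hl
  have hlc : Continuous l := by
    refine continuous_const.max (continuous_const.min (continuous_const.sub ?_))
    exact (continuous_const.mul hf.norm).div_const δ
  refine ⟨fun x => f x + l x • (g x - f x), hf.add (hlc.smul (hg.sub hf)), fun x hx => ?_,
    fun x hx => ?_⟩
  · beta_reduce at hx
    rcases le_or_gt ‖f x‖ (δ / 2) with hx' | hx'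
    · have hle : 2 * ‖f x‖ / δ ≤ 1 := by
        rw [div_le_one hδ]
        linarith
      have h1 : l x = 1 := by
        simp only [hl]
        rw [min_eq_left (by linarith), max_eq_right zero_le_one]
      rw [h1, one_smul, add_sub_cancel] at hx
      exact hg0 x hx
    · have hl0 : 0 ≤ l x := le_max_left _ _
      have hl1 : l x ≤ 1 := max_le zero_le_one (min_le_left _ _)
      have heq : f x = l x • (f x - g x) := by
        rw [← sub_eq_zero, ← hx, smul_sub, smul_sub]
        abel
      have hn := congrArg norm heq
      rw [norm_smul, Real.norm_of_nonneg hl0] at hn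
      nlinarith [hfg x, norm_nonneg (f x - g x)]
  · have hle : 2 ≤ 2 * ‖f x‖ / δ := by
      rw [le_div_iff₀ hδ]
      linarith
    have h0 : l x = 0 := max_eq_left ((min_le_right _ _).trans (by linarith))
    simp [h0]

/-- Under the approximation property, every open cover by `n + 2` sets shrinks to an open cover
whose members have no common point. -/
theorem ApproxNeZero.exists_shrinking_iInter_eq_empty {X : Type*} [TopologicalSpace X]
    [NormalSpace X] {n : ℕ} (h : ApproxNeZero X n) {U : Fin (n + 2) → Set X}
    (hU : ∀ i, IsOpen (U i)) (hcov : ⋃ i, U i = Set.univ) :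
    ∃ W : Fin (n + 2) → Set X, (∀ i, IsOpen (W i)) ∧ ⋃ i, W i = Set.univ ∧ (∀ i, W i ⊆ U i) ∧
      ⋂ i, W i = ∅ := by
  obtain ⟨φ, hφc, hφ0, hφ1, hφU⟩ := exists_continuous_sum_eq_one_of_open_cover hU hcov
  set f : X → EuclideanSpace ℝ (Fin (n + 1)) :=
    fun x => WithLp.toLp 2 fun i => φ i.succ x - φ 0 x with hf
  have hfc : Continuous f := (PiLp.continuous_toLp 2 _).comp
    (continuous_pi fun i => (hφc i.succ).sub (hφc 0))
  have hcoord : ∀ x k, |φ k x - φ 0 x| ≤ ‖f x‖ := fun x k => by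
    refine Fin.cases ?_ (fun i => ?_) k
    · simp
    · exact PiLp.norm_apply_le (f x) i
  set δ : ℝ := 1 / (2 * (n + 2)) with hδ
  obtain ⟨g, hgc, hg0, hgf⟩ := h.exists_eq_of_le hfc (δ := δ) (by positivity)
  have hlarge : ∀ x i, φ i x = 0 → δ ≤ ‖f x‖ := by
    intro x i hi
    by_contra! hlt
    have hk : ∀ k, φ k x < 1 / (n + 2) := fun k => by
      have h1 := abs_le.1 (hcoord x k)
      have h2 := abs_le.1 (hcoord x i)
      have h3 : (1 : ℝ) / (n + 2) = 2 * δ := by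
        rw [hδ]
        field_simp
      linarith [h1.2, h2.1]
    have hlt' := Finset.sum_lt_sum_of_nonempty Finset.univ_nonempty fun k _ => hk k
    rw [hφ1, Finset.sum_const, Finset.card_univ, Fintype.card_fin, nsmul_eq_mul] at hlt'
    push_cast at hlt'
    rw [mul_one_div_cancel (by positivity)] at hlt'
    exact lt_irrefl _ hlt'
  set ψ : Fin (n + 2) → X → ℝ := fun i x => Fin.cons (α := fun _ => ℝ) 0 (g x).ofLp i with hψ
  have hψc : ∀ i, Continuous (ψ i) := by
    refine Fin.cases continuous_const fun i => ?_
    exact (continuous_apply i).comp ((PiLp.continuous_ofLp 2 _).comp hgc)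
  refine ⟨fun i => {x | ∃ j, ψ j x < ψ i x}, fun i => ?_, ?_, fun i x hx => ?_, ?_⟩
  · simp only [Set.ofPred_exists]
    exact isOpen_iUnion fun j => isOpen_lt (hψc j) (hψc i)
  · refine Set.eq_univ_of_forall fun x => ?_
    by_contra hx
    simp only [Set.mem_iUnion, Set.mem_ofPred_eq, not_exists, not_lt] at hx
    refine hg0 x (PiLp.ext fun i => ?_)
    exact le_antisymm (hx i.succ 0) (hx 0 i.succ)
  · by_contra hxU
    have hi : φ i x = 0 := not_not.1 fun hne => hxU (hφU i x hne)
    have hψφ : ∀ k, ψ k x = φ k x - φ 0 x := by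
      refine Fin.cases (by simp [hψ]) fun k => ?_
      simp only [hψ, Fin.cons_succ, hgf x (hlarge x i hi), hf]
    obtain ⟨j, hj⟩ := hx
    rw [hψφ, hψφ, hi] at hj
    linarith [hφ0 j x]
  · refine Set.eq_empty_of_forall_notMem fun x hx => ?_
    obtain ⟨i, hi⟩ := Finite.exists_min fun i => ψ i x
    obtain ⟨j, hj⟩ := Set.mem_iInter.1 hx i
    exact hj.not_ge (hi j)

/-- Under the approximation property, any open cover can be shrunk so that `n + 2` given members
have no common point. -/
theorem ApproxNeZero.exists_shrinking_iInter_comp_eq_empty {X ι : Type*} [TopologicalSpace X]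
    [NormalSpace X] {n : ℕ} (h : ApproxNeZero X n) {U : ι → Set X}
    (hU : ∀ i, IsOpen (U i)) (hcov : ⋃ i, U i = Set.univ) (s : Fin (n + 2) ↪ ι) :
    ∃ W : ι → Set X, (∀ i, IsOpen (W i)) ∧ ⋃ i, W i = Set.univ ∧ (∀ i, W i ⊆ U i) ∧
      ⋂ k, W (s k) = ∅ := by
  set B : Set X := ⋃ i ∈ (Set.range s)ᶜ, U i with hB
  have hBo : IsOpen B := isOpen_biUnion fun i _ => hU i
  obtain ⟨W, hWo, hWc, hWU, hWe⟩ := h.exists_shrinking_iInter_eq_empty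
    (U := fun k => U (s k) ∪ B) (fun k => (hU _).union hBo) (by
      refine Set.eq_univ_of_forall fun x => ?_
      obtain ⟨i, hi⟩ := Set.mem_iUnion.1 (hcov.ge (Set.mem_univ x))
      by_cases his : i ∈ Set.range s
      · obtain ⟨k, rfl⟩ := his
        exact Set.mem_iUnion.2 ⟨k, Or.inl hi⟩
      · exact Set.mem_iUnion.2 ⟨0, Or.inr (Set.mem_biUnion his hi)⟩)
  refine ⟨fun i => U i ∩ ⋂ k, ⋂ (_ : s k = i), W k, fun i => (hU i).inter ?_, ?_,
    fun i => Set.inter_subset_left, ?_⟩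
  · exact isOpen_iInter_of_finite fun k => isOpen_iInter_of_finite fun _ => hWo k
  · refine Set.eq_univ_of_forall fun x => ?_
    obtain ⟨k, hk⟩ := Set.mem_iUnion.1 (hWc.ge (Set.mem_univ x))
    rcases hWU k hk with hx | hx
    · refine Set.mem_iUnion.2 ⟨s k, hx, Set.mem_iInter₂.2 fun l hl => ?_⟩
      rwa [s.injective hl]
    · obtain ⟨i, hi, hxi⟩ := Set.mem_iUnion₂.1 hx
      exact Set.mem_iUnion.2 ⟨i, hxi, Set.mem_iInter₂.2 fun l hl => absurd ⟨l, hl⟩ hi⟩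
  · refine Set.eq_empty_of_forall_notMem fun x hx => ?_
    refine Set.notMem_empty x (hWe ▸ Set.mem_iInter.2 fun k => ?_)
    exact Set.mem_iInter₂.1 (Set.mem_iInter.1 hx k).2 k rfl

theorem ApproxNeZero.covDimLE {X : Type*} [TopologicalSpace X] [NormalSpace X] {n : ℕ}
    (h : ApproxNeZero X n) : CovDimLE X n := by
  classical
  intro ι _ U hU hcov
  have := Fintype.ofFinite ι
  have key : ∀ S : Finset (Fin (n + 2) ↪ ι), ∃ W : ι → Set X, (∀ i, IsOpen (W i)) ∧
      ⋃ i, W i = Set.univ ∧ (∀ i, W i ⊆ U i) ∧ ∀ s ∈ S, ⋂ k, W (s k) = ∅ := by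
    intro S
    induction S using Finset.induction_on with
    | empty => exact ⟨U, hU, hcov, fun _ => subset_rfl, by simp⟩
    | insert s S _ ih =>
      obtain ⟨W, hWo, hWc, hWU, hWS⟩ := ih
      obtain ⟨W', hWo', hWc', hWW', hWs'⟩ :=
        h.exists_shrinking_iInter_comp_eq_empty hWo hWc s
      refine ⟨W', hWo', hWc', fun i => (hWW' i).trans (hWU i), fun r hr => ?_⟩
      rcases Finset.mem_insert.1 hr with rfl | hr
      · exact hWs'
      · exact Set.subset_empty_iff.1
          ((Set.iInter_mono fun k => hWW' (r k)).trans (hWS r hr).subset)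
  obtain ⟨W, hWo, hWc, hWU, hWe⟩ := key Finset.univ
  refine ⟨ι, inferInstance, W, hWo, hWc, fun i => ⟨i, hWU i⟩, fun x => ?_⟩
  by_contra! hlt
  rw [← Nat.card_coe_set_eq, Nat.card_eq_fintype_card] at hlt
  obtain ⟨e⟩ : Nonempty (Fin (n + 2) ↪ {j | x ∈ W j}) :=
    Function.Embedding.nonempty_of_card_le (by rw [Fintype.card_fin]; exact hlt)
  refine Set.notMem_empty x
    (hWe (e.trans (Function.Embedding.subtype _)) (Finset.mem_univ _) ▸ ?_)
  exact Set.mem_iInter.2 fun k => (e k).2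

/-- A normal space `X` has covering dimension at most `n` iff every continuous map
`f : X → ℝ^{n+1}` can be uniformly approximated by continuous maps avoiding the origin. -/
theorem stmt1 {X : Type*} [TopologicalSpace X] [NormalSpace X] (n : ℕ) :
    CovDimLE X n ↔
      ∀ f : X → EuclideanSpace ℝ (Fin (n + 1)), Continuous f → ∀ ε > (0 : ℝ),
        ∃ g : X → EuclideanSpace ℝ (Fin (n + 1)), Continuous g ∧ (∀ x, g x ≠ 0) ∧
          ∀ x, ‖f x - g x‖ ≤ ε := by
  exact ⟨fun h _ hf _ hε => h.exists_ne_zero (by simp) hf hε, ApproxNeZero.covDimLE⟩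
end

section
/- Let Γ be a countable group, A a finite set, X ⊆ A^Γ a subshift, and a a Γ-flow on a nonempty compact Hausdorff space Y. Then a weakly contains the shift flow on X if and only if for every shift of finite type X̃ ⊆ A^Γ with X ⊆ X̃ and every finite list of clopen sets U_1, …, U_n ⊆ A^Γ with U_i ∩ X ≠ ∅ for each i, there is a continuous Γ-equivariant map f : Y → X̃ whose image meets each U_i. -/
/-- The left shift action of `Γ` on `A^Γ`: `(γ·x)(δ) = x(γ⁻¹δ)`. -/
def shiftMap {Γ : Type*} [Group Γ] {A : Type*} (γ : Γ) (x : Γ → A) : Γ → A :=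
  fun δ => x (γ⁻¹ * δ)

/-- The shift action restricted to a shift-invariant subset `X ⊆ A^Γ`. -/
def subshiftAct {Γ : Type*} [Group Γ] {A : Type*} (X : Set (Γ → A))
    (hX : ∀ γ : Γ, ∀ x ∈ X, shiftMap γ x ∈ X) : Γ → X → X :=
  fun γ x => ⟨shiftMap γ x.1, hX γ x.1 x.2⟩

/-- A shift of finite type: a nonempty subset of `A^Γ` cut out by a set of allowed patterns
on a finite window `W`. -/
def IsSFT {Γ : Type*} [Group Γ] {A : Type*} (Y : Set (Γ → A)) : Prop :=
  Y.Nonempty ∧ ∃ (W : Finset Γ) (P : Set ({γ // γ ∈ W} → A)),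
    Y = {x | ∀ γ : Γ, (fun w : {γ // γ ∈ W} => shiftMap γ x w.1) ∈ P}

/-- The `W`-local pattern of a finite family of sets. -/
def localPattern {Γ : Type*} {X : Type*} (a : Γ → X → X) (W : Finset Γ) {k : ℕ}
    (C : Fin k → Set X) : Set (Set (Fin k × Γ)) :=
  {σ | (∀ p ∈ σ, p.2 ∈ W) ∧ (⋂ p ∈ σ, a p.2 '' C p.1).Nonempty}

/-- `𝒫_{W,k}(a)`: the set of all `W`-local patterns of closed covers by `k` closed sets. -/
def coverPatterns {Γ : Type*} {X : Type*} [TopologicalSpace X] (a : Γ → X → X) (W : Finset Γ)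
    (k : ℕ) : Set (Set (Set (Fin k × Γ))) :=
  {P | ∃ C : Fin k → Set X, (∀ i, IsClosed (C i)) ∧ (⋃ i, C i) = Set.univ ∧
    localPattern a W C = P}

/-- `a` weakly contains `b`. -/
def WeaklyContains {Γ : Type*} {X Y : Type*} [TopologicalSpace X] [TopologicalSpace Y]
    (a : Γ → X → X) (b : Γ → Y → Y) : Prop :=
  ∀ (W : Finset Γ) (k : ℕ), coverPatterns b W k ⊆ coverPatterns a W k

/-- A translate of a set under an action, described by the inverse group element. -/
theorem mem_image_act_iff {Γ Y : Type*} [Group Γ] {a : Γ → Y → Y}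
    (ha_one : ∀ y, a 1 y = y) (ha_mul : ∀ γ δ y, a (γ * δ) y = a γ (a δ y))
    (γ : Γ) (C : Set Y) (y : Y) : y ∈ a γ '' C ↔ a γ⁻¹ y ∈ C := by
  constructor
  · rintro ⟨z, hz, rfl⟩
    rwa [← ha_mul, inv_mul_cancel, ha_one]
  · intro h
    exact ⟨_, h, by rw [← ha_mul, mul_inv_cancel, ha_one]⟩

theorem mem_localPattern_iff {Γ Y : Type*} [Group Γ] {a : Γ → Y → Y}
    (ha_one : ∀ y, a 1 y = y) (ha_mul : ∀ γ δ y, a (γ * δ) y = a γ (a δ y))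
    {W : Finset Γ} {k : ℕ} {C : Fin k → Set Y} {σ : Set (Fin k × Γ)} :
    σ ∈ localPattern a W C ↔
      (∀ p ∈ σ, p.2 ∈ W) ∧ ∃ y, ∀ p ∈ σ, a p.2⁻¹ y ∈ C p.1 := by
  simp only [localPattern, Set.mem_ofPred_eq, Set.Nonempty, Set.mem_iInter,
    mem_image_act_iff ha_one ha_mul]

section Shift

variable {Γ : Type*} [Group Γ] {A : Type*}

theorem shiftMap_one (x : Γ → A) : shiftMap 1 x = x := by
  funext δ
  simp [shiftMap]

theorem shiftMap_mul (γ δ : Γ) (x : Γ → A) :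
    shiftMap (γ * δ) x = shiftMap γ (shiftMap δ x) := by
  funext ε
  simp [shiftMap, mul_assoc]

theorem continuous_shiftMap [TopologicalSpace A] (γ : Γ) :
    Continuous (shiftMap γ : (Γ → A) → Γ → A) :=
  continuous_pi fun δ => continuous_apply (γ⁻¹ * δ)

theorem subshiftAct_one (X : Set (Γ → A)) (hX : ∀ γ : Γ, ∀ x ∈ X, shiftMap γ x ∈ X) (x : X) :
    subshiftAct X hX 1 x = x :=
  Subtype.ext (shiftMap_one x.1)

theorem subshiftAct_mul (X : Set (Γ → A)) (hX : ∀ γ : Γ, ∀ x ∈ X, shiftMap γ x ∈ X)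
    (γ δ : Γ) (x : X) :
    subshiftAct X hX (γ * δ) x = subshiftAct X hX γ (subshiftAct X hX δ x) :=
  Subtype.ext (shiftMap_mul γ δ x.1)

end Shift

section Window

variable {Γ : Type*} {A : Type*}

/-- The points that agree on the window `F` with some point of `C`. -/
def windowHull (F : Finset Γ) (C : Set (Γ → A)) : Set (Γ → A) :=
  {x | ∃ y ∈ C, Set.EqOn x y F}

theorem subset_windowHull (F : Finset Γ) (C : Set (Γ → A)) : C ⊆ windowHull F C :=
  fun x hx => ⟨x, hx, fun _ _ => rfl⟩

theorem windowHull_anti (C : Set (Γ → A)) : Antitone fun F : Finset Γ => windowHull F C :=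
  fun _ _ h _ ⟨y, hy, hxy⟩ => ⟨y, hy, hxy.mono h⟩

theorem mem_windowHull_congr {F : Finset Γ} {C : Set (Γ → A)} {x y : Γ → A}
    (h : Set.EqOn x y F) : x ∈ windowHull F C ↔ y ∈ windowHull F C :=
  ⟨fun ⟨z, hz, hxz⟩ => ⟨z, hz, h.symm.trans hxz⟩, fun ⟨z, hz, hyz⟩ => ⟨z, hz, h.trans hyz⟩⟩

theorem mem_of_forall_mem_windowHull [TopologicalSpace A] {C : Set (Γ → A)} (hC : IsClosed C)
    {x : Γ → A}
    (hx : ∀ F : Finset Γ, x ∈ windowHull F C) : x ∈ C := by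
  rw [← hC.closure_eq, mem_closure_iff]
  intro U hU hxU
  obtain ⟨F, u, hu, hFU⟩ := isOpen_pi_iff.1 hU x hxU
  obtain ⟨y, hy, hxy⟩ := hx F
  exact ⟨y, hFU fun i hi => hxy hi ▸ (hu i hi).2, hy⟩

variable [TopologicalSpace A] [DiscreteTopology A]

theorem isClopen_windowHull (F : Finset Γ) (C : Set (Γ → A)) : IsClopen (windowHull F C) := by
  have h : windowHull F C =
      (fun (x : Γ → A) (w : F) => x w) ⁻¹' {p | ∃ y ∈ C, ∀ w : F, p w = y w} := by
    ext x
    simp [windowHull, Set.EqOn]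
  rw [h]
  exact (isClopen_discrete _).preimage (continuous_pi fun w => continuous_apply w.1)

/-- A clopen set of configurations depends on finitely many coordinates only. -/
theorem IsClopen.exists_finset_window [Finite A] {U : Set (Γ → A)} (hU : IsClopen U) :
    ∃ F : Finset Γ, ∀ x y, Set.EqOn x y F → x ∈ U → y ∈ U := by
  classical
  by_contra! h
  have key := IsCompact.nonempty_iInter_of_directed_nonempty_isCompact_isClosed
    (fun F : Finset Γ => windowHull F U ∩ Uᶜ)
    (directed_of_isDirected_le fun F G hFG => Set.inter_subset_inter_left _
      (windowHull_anti U hFG))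
    (fun F => by
      obtain ⟨x, y, hxy, hx, hy⟩ := h F
      exact ⟨y, ⟨x, hx, hxy.symm⟩, hy⟩)
    (fun F => ((isClopen_windowHull F U).inter hU.compl).isClosed.isCompact)
    (fun F => ((isClopen_windowHull F U).inter hU.compl).isClosed)
  obtain ⟨x, hx⟩ := key
  rw [Set.mem_iInter] at hx
  exact (hx ∅).2 (mem_of_forall_mem_windowHull hU.isClosed fun F => (hx F).1)

end Window

section ShiftWindow

variable {Γ : Type*} [Group Γ] {A : Type*}

/-- The configurations whose translates all look like a point of `X` on the window `V`
form a shift of finite type. -/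
theorem isSFT_windowHull {X : Set (Γ → A)} (hXne : X.Nonempty)
    (hXinv : ∀ γ : Γ, ∀ x ∈ X, shiftMap γ x ∈ X) (V : Finset Γ) :
    IsSFT {x | ∀ γ : Γ, shiftMap γ x ∈ windowHull V X} := by
  refine ⟨hXne.mono fun x hx γ => subset_windowHull V X (hXinv γ x hx), V,
    {p | ∃ y ∈ X, ∀ w : {γ // γ ∈ V}, p w = y w.1}, ?_⟩
  ext x
  simp [windowHull, Set.EqOn]

/-- If translates of closed sets have no common point in a subshift, then neither do the translates
of their hulls for some window. -/
theorem exists_window_of_inter_eq_empty [Finite A] [TopologicalSpace A]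
    [DiscreteTopology A] {X : Set (Γ → A)} (hXcl : IsClosed X)
    {k : ℕ} {C : Fin k → Set (Γ → A)} (hC : ∀ i, IsClosed (C i)) {σ : Set (Fin k × Γ)}
    (hσ : ¬ ∃ x ∈ X, ∀ p ∈ σ, shiftMap p.2⁻¹ x ∈ C p.1) :
    ∃ F : Finset Γ, ¬ ∃ x ∈ X, ∀ p ∈ σ, shiftMap p.2⁻¹ x ∈ windowHull F (C p.1) := by
  classical
  by_contra! h
  have hcl : ∀ F : Finset Γ,
      IsClosed {x | x ∈ X ∧ ∀ p ∈ σ, shiftMap p.2⁻¹ x ∈ windowHull F (C p.1)} := by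
    intro F
    rw [show {x | x ∈ X ∧ ∀ p ∈ σ, shiftMap p.2⁻¹ x ∈ windowHull F (C p.1)} =
      X ∩ ⋂ p ∈ σ, shiftMap p.2⁻¹ ⁻¹' windowHull F (C p.1) by ext; simp]
    exact hXcl.inter (isClosed_biInter fun p _ =>
      (isClopen_windowHull F _).isClosed.preimage (continuous_shiftMap _))
  obtain ⟨x, hx⟩ := IsCompact.nonempty_iInter_of_directed_nonempty_isCompact_isClosed
    (fun F : Finset Γ => {x | x ∈ X ∧ ∀ p ∈ σ, shiftMap p.2⁻¹ x ∈ windowHull F (C p.1)})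
    (directed_of_isDirected_le fun F G hFG x hx =>
      ⟨hx.1, fun p hp => windowHull_anti _ hFG (hx.2 p hp)⟩)
    h (fun F => (hcl F).isCompact) hcl
  rw [Set.mem_iInter] at hx
  exact hσ ⟨x, (hx ∅).1, fun p hp =>
    mem_of_forall_mem_windowHull (hC p.1) fun F => (hx F).2 p hp⟩

end ShiftWindow

section WeakContainment

variable {Γ : Type*} [Group Γ] {A : Type*} [Finite A] [TopologicalSpace A] [DiscreteTopology A]
  {X : Set (Γ → A)} {hXinv : ∀ γ : Γ, ∀ x ∈ X, shiftMap γ x ∈ X}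
  {Y : Type*} [TopologicalSpace Y] {a : Γ → Y → Y}

/-- If a flow weakly contains the subshift `X`, then it has equivariant maps to `A^Γ` which see
exactly the patterns of `X` on any prescribed finite window. -/
theorem WeaklyContains.exists_equivariant (h : WeaklyContains a (subshiftAct X hXinv))
    (ha_one : ∀ y, a 1 y = y) (ha_mul : ∀ γ δ y, a (γ * δ) y = a γ (a δ y))
    (ha_cont : ∀ γ, Continuous (a γ)) (V : Finset Γ) :
    ∃ f : Y → Γ → A, Continuous f ∧ (∀ γ y, f (a γ y) = shiftMap γ (f y)) ∧
      (∀ y, f y ∈ windowHull V X) ∧ ∀ x ∈ X, ∃ y, Set.EqOn (f y) x V := by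
  classical
  wlog hV : (1 : Γ) ∈ V generalizing V
  · obtain ⟨f, hf, hfeq, hfX, hfU⟩ := this (insert 1 V) (Finset.mem_insert_self _ _)
    exact ⟨f, hf, hfeq, fun y => windowHull_anti X (Finset.subset_insert 1 V) (hfX y),
      fun x hx => (hfU x hx).imp fun y hy => hy.mono (by simp)⟩
  obtain ⟨k, ⟨e⟩⟩ := Finite.exists_equiv_fin A
  obtain ⟨D, hDcl, hDcov, hD⟩ := h V k
    ⟨fun i => {x : X | e (x.1 1) = i},
      fun i => (isClosed_discrete {b : A | e b = i}).preimage
        (f := fun x : X => x.1 1) ((continuous_apply (1 : Γ)).comp continuous_subtype_val),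
      by ext x; simp, rfl⟩
  have hpat : ∀ σ : Set (Fin k × Γ), (∀ p ∈ σ, p.2 ∈ V) →
      ((∃ y, ∀ p ∈ σ, a p.2⁻¹ y ∈ D p.1) ↔ ∃ x ∈ X, ∀ p ∈ σ, e (x p.2) = p.1) := by
    intro σ hσ
    have := Set.ext_iff.1 hD σ
    rw [mem_localPattern_iff ha_one ha_mul,
      mem_localPattern_iff (subshiftAct_one X hXinv) (subshiftAct_mul X hXinv)] at this
    simpa [subshiftAct, shiftMap] using (and_congr_right_iff.1 this) hσ
  have hcov : ∀ y, ∃ b : A, y ∈ D (e b) := by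
    intro y
    obtain ⟨i, hi⟩ := Set.mem_iUnion.1 (hDcov ▸ Set.mem_univ y)
    exact ⟨e.symm i, by simpa using hi⟩
  choose g hg using hcov
  have hguniq : ∀ y b, y ∈ D (e b) → g y = b := by
    intro y b hb
    obtain ⟨x, -, hx⟩ := (hpat {(e (g y), 1), (e b, 1)} (by simp [hV])).1
      ⟨y, by simp [ha_one, hg, hb]⟩
    simp only [Set.mem_insert_iff, Set.mem_singleton_iff, forall_eq_or_imp, forall_eq,
      EmbeddingLike.apply_eq_iff_eq] at hx
    exact hx.1.symm.trans hx.2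
  have hgcont : Continuous g := by
    rw [continuous_iff_isClosed]
    intro s _
    have : g ⁻¹' s = ⋃ b ∈ s, D (e b) := by
      ext y
      simp only [Set.mem_preimage, Set.mem_iUnion, exists_prop]
      exact ⟨fun hy => ⟨_, hy, hg y⟩, fun ⟨b, hb, hy⟩ => hguniq y b hy ▸ hb⟩
    rw [this]
    exact s.toFinite.isClosed_biUnion fun b _ => hDcl _
  refine ⟨fun y γ => g (a γ⁻¹ y), continuous_pi fun γ => hgcont.comp (ha_cont _), ?_, ?_, ?_⟩
  · intro γ y
    funext δ
    simp [shiftMap, ← ha_mul]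
  · intro y
    obtain ⟨x, hx, hxy⟩ := (hpat {p | p.2 ∈ V ∧ p.1 = e (g (a p.2⁻¹ y))} (fun p hp => hp.1)).1
      ⟨y, fun p hp => hp.2 ▸ hg _⟩
    exact ⟨x, hx, fun γ hγ => (e.injective (hxy (_, γ) ⟨hγ, rfl⟩)).symm⟩
  · intro x hx
    obtain ⟨y, hy⟩ := (hpat {p | p.2 ∈ V ∧ p.1 = e (x p.2)} (fun p hp => hp.1)).2
      ⟨x, hx, fun p hp => hp.2.symm⟩
    exact ⟨y, fun γ hγ => hguniq _ _ (hy (_, γ) ⟨hγ, rfl⟩)⟩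

/-- If a flow has, for every finite window, an equivariant map to `A^Γ` seeing exactly the
patterns of `X` on that window, then it weakly contains `X`. -/
theorem weaklyContains_of_exists_equivariant (hXcl : IsClosed X)
    (ha_one : ∀ y, a 1 y = y) (ha_mul : ∀ γ δ y, a (γ * δ) y = a γ (a δ y))
    (h : ∀ V : Finset Γ, ∃ f : Y → Γ → A, Continuous f ∧
      (∀ γ y, f (a γ y) = shiftMap γ (f y)) ∧
      (∀ y, f y ∈ windowHull V X) ∧ ∀ x ∈ X, ∃ y, Set.EqOn (f y) x V) :
    WeaklyContains a (subshiftAct X hXinv) := by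
  classical
  rintro W k _ ⟨C, hCcl, hCcov, rfl⟩
  set C' : Fin k → Set (Γ → A) := fun i => Subtype.val '' C i
  have hC'cl : ∀ i, IsClosed (C' i) := fun i => hXcl.isClosedEmbedding_subtypeVal.isClosedMap _
    (hCcl i)
  have hpat : ∀ σ : Set (Fin k × Γ), (∃ x, ∀ p ∈ σ, subshiftAct X hXinv p.2⁻¹ x ∈ C p.1) ↔
      ∃ x ∈ X, ∀ p ∈ σ, shiftMap p.2⁻¹ x ∈ C' p.1 := by
    intro σ
    constructor
    · rintro ⟨x, hx⟩
      exact ⟨x, x.2, fun p hp => ⟨_, hx p hp, rfl⟩⟩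
    · rintro ⟨x, hxX, hx⟩
      refine ⟨⟨x, hxX⟩, fun p hp => ?_⟩
      obtain ⟨z, hz, hzx⟩ := hx p hp
      rwa [show subshiftAct X hXinv p.2⁻¹ ⟨x, hxX⟩ = z from Subtype.ext hzx.symm]
  have hfin : {σ : Set (Fin k × Γ) | ∀ p ∈ σ, p.2 ∈ W}.Finite :=
    ((Finset.univ ×ˢ W : Finset (Fin k × Γ)).finite_toSet.powerset).subset
      fun σ hσ p hp => by simpa using hσ p hp
  obtain ⟨F, hF⟩ : ∃ F : Finset Γ, ∀ σ : Set (Fin k × Γ), (∀ p ∈ σ, p.2 ∈ W) →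
      (∃ x ∈ X, ∀ p ∈ σ, shiftMap p.2⁻¹ x ∈ windowHull F (C' p.1)) →
      ∃ x ∈ X, ∀ p ∈ σ, shiftMap p.2⁻¹ x ∈ C' p.1 := by
    have hex : ∀ σ : Set (Fin k × Γ), ∃ F : Finset Γ,
        (∃ x ∈ X, ∀ p ∈ σ, shiftMap p.2⁻¹ x ∈ windowHull F (C' p.1)) →
        ∃ x ∈ X, ∀ p ∈ σ, shiftMap p.2⁻¹ x ∈ C' p.1 := by
      intro σ
      by_cases hσ : ∃ x ∈ X, ∀ p ∈ σ, shiftMap p.2⁻¹ x ∈ C' p.1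
      · exact ⟨∅, fun _ => hσ⟩
      · exact (exists_window_of_inter_eq_empty hXcl hC'cl hσ).imp fun F hF h => absurd h hF
    choose F hF using hex
    obtain ⟨G, hG⟩ := (hfin.image F).bddAbove
    refine ⟨G, fun σ hσ ⟨x, hx, hxσ⟩ => hF σ ⟨x, hx, fun p hp => ?_⟩⟩
    exact windowHull_anti _ (hG ⟨σ, hσ, rfl⟩) (hxσ p hp)
  obtain ⟨f, hf, hfeq, hfX, hfU⟩ := h (F ∪ Finset.image₂ (· * ·) W F)
  have hshift : ∀ γ ∈ W, ∀ x y : Γ → A,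
      Set.EqOn x y ↑(F ∪ Finset.image₂ (· * ·) W F) →
      Set.EqOn (shiftMap γ⁻¹ x) (shiftMap γ⁻¹ y) F := by
    intro γ hγ x y hxy δ hδ
    simp only [shiftMap, inv_inv]
    exact hxy (Finset.mem_coe.2 (Finset.mem_union_right _
      (Finset.mem_image₂_of_mem hγ (Finset.mem_coe.1 hδ))))
  refine ⟨fun i => f ⁻¹' windowHull F (C' i),
    fun i => (isClopen_windowHull F _).isClosed.preimage hf, ?_, ?_⟩
  · refine Set.eq_univ_of_forall fun y => ?_
    obtain ⟨x, hx, hyx⟩ := hfX y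
    obtain ⟨i, hi⟩ := Set.mem_iUnion.1 (hCcov ▸ Set.mem_univ (⟨x, hx⟩ : X))
    exact Set.mem_iUnion.2 ⟨i, x, ⟨_, hi, rfl⟩, hyx.mono (by simp)⟩
  · ext σ
    rw [mem_localPattern_iff ha_one ha_mul,
      mem_localPattern_iff (subshiftAct_one X hXinv) (subshiftAct_mul X hXinv), hpat]
    refine and_congr_right fun hσ => ⟨fun ⟨y, hy⟩ => hF σ hσ ?_, fun ⟨x, hx, hxσ⟩ => ?_⟩
    · obtain ⟨x, hx, hyx⟩ := hfX y
      refine ⟨x, hx, fun p hp => ?_⟩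
      have := hy p hp
      rw [Set.mem_preimage, hfeq] at this
      exact (mem_windowHull_congr (hshift p.2 (hσ p hp) _ _ hyx)).1 this
    · obtain ⟨y, hyx⟩ := hfU x hx
      refine ⟨y, fun p hp => ?_⟩
      rw [Set.mem_preimage, hfeq]
      exact (mem_windowHull_congr (hshift p.2 (hσ p hp) _ _ hyx)).2
        (subset_windowHull F _ (hxσ p hp))

end WeakContainment

/-- A Γ-flow `a` weakly contains a subshift `X ⊆ A^Γ` iff for every shift of finite type
`X̃ ⊇ X` and every finite list of clopen sets meeting `X`, there is a continuous equivariant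
map from `a` into `X̃` whose image meets each of the clopen sets. -/
theorem stmt8 {Γ : Type*} [Group Γ] [Countable Γ]
    {A : Type*} [Finite A] [TopologicalSpace A] [DiscreteTopology A]
    (X : Set (Γ → A)) (hXne : X.Nonempty) (hXcl : IsClosed X)
    (hXinv : ∀ γ : Γ, ∀ x ∈ X, shiftMap γ x ∈ X)
    {Y : Type*} [TopologicalSpace Y] [CompactSpace Y] [T2Space Y] [Nonempty Y]
    (a : Γ → Y → Y)
    (ha_one : ∀ y, a 1 y = y) (ha_mul : ∀ γ δ y, a (γ * δ) y = a γ (a δ y))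
    (ha_cont : ∀ γ, Continuous (a γ)) :
    WeaklyContains a (subshiftAct X hXinv) ↔
      ∀ X' : Set (Γ → A), IsSFT X' → X ⊆ X' →
        ∀ (n : ℕ) (U : Fin n → Set (Γ → A)),
          (∀ i, IsClopen (U i)) → (∀ i, (U i ∩ X).Nonempty) →
          ∃ f : Y → Γ → A, Continuous f ∧ (∀ y, f y ∈ X') ∧
            (∀ γ y, f (a γ y) = shiftMap γ (f y)) ∧
            ∀ i, ∃ y, f y ∈ U i := by
  classical
  constructor
  · rintro h X' ⟨-, W, P, rfl⟩ hXX' n U hU hUX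
    choose G hG using fun i => (hU i).exists_finset_window
    obtain ⟨f, hf, hfeq, hfX, hfU⟩ := h.exists_equivariant ha_one ha_mul ha_cont
      (W ∪ Finset.univ.biUnion G)
    refine ⟨f, hf, fun y γ => ?_, hfeq, fun i => ?_⟩
    · obtain ⟨x, hx, hyx⟩ := hfX (a γ y)
      have hxP := hXX' hx 1
      rw [shiftMap_one] at hxP
      rw [← hfeq]
      convert hxP using 2 with w
      exact hyx (by simp)
    · obtain ⟨x, hxU, hxX⟩ := hUX i
      obtain ⟨y, hyx⟩ := hfU x hxX
      refine ⟨y, hG i x _ (fun γ hγ => (hyx ?_).symm) hxU⟩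
      simp only [Finset.coe_union, Finset.coe_biUnion, Set.mem_union, Set.mem_iUnion]
      exact Or.inr ⟨i, by simp, hγ⟩
  · intro h
    refine weaklyContains_of_exists_equivariant hXcl ha_one ha_mul fun V => ?_
    obtain ⟨n, ⟨e⟩⟩ := Finite.exists_equiv_fin (Set.range fun (x : X) (v : V) => x.1 v.1)
    choose r hr using fun p : Set.range fun (x : X) (v : V) => x.1 v.1 => p.2
    obtain ⟨f, hf, hfX, hfeq, hfU⟩ := h _ (isSFT_windowHull hXne hXinv V)
      (fun x hx γ => subset_windowHull V X (hXinv γ x hx)) n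
      (fun i => windowHull V {(r (e.symm i)).1}) (fun i => isClopen_windowHull V _)
      (fun i => ⟨_, subset_windowHull V _ rfl, (r (e.symm i)).2⟩)
    refine ⟨f, hf, hfeq, fun y => ?_, fun x hx => ?_⟩
    · simpa only [shiftMap_one] using hfX y 1
    · obtain ⟨y, z, rfl, hy⟩ := hfU (e ⟨_, ⟨⟨x, hx⟩, rfl⟩⟩)
      rw [Equiv.symm_apply_apply] at hy
      exact ⟨y, fun γ hγ => (hy hγ).trans (congrFun (hr ⟨_, ⟨⟨x, hx⟩, rfl⟩⟩) ⟨γ, hγ⟩)⟩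
end

section
/- Let Γ be a countable group. (1) There is an action a_⊤ of Γ on Cantor space which weakly contains every action of Γ on Cantor space. (2) There is a free action of Γ on Cantor space which weakly contains every free action of Γ on Cantor space. (3) There is a topologically mixing action of Γ on Cantor space which weakly contains every topologically mixing action of Γ on Cantor space. -/
/-- An action of `Γ` by homeomorphisms on a Cantor space (a space homeomorphic to
`{0,1}^ℕ`). -/
structure CantorFlow (Γ : Type*) [Group Γ] where
  X : Type
  [ts : TopologicalSpace X]
  cantor : Nonempty (X ≃ₜ (ℕ → Bool))
  act : Γ → X → X
  act_one : ∀ x, act 1 x = x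
  act_mul : ∀ γ δ x, act (γ * δ) x = act γ (act δ x)
  act_cont : ∀ γ, Continuous (act γ)

attribute [instance] CantorFlow.ts

/-- The set of `W`-local patterns of a labelling `f : X → Fin k` with respect to an action
`a : Γ → X → X`. -/
def labelPattern {Γ : Type*} {X : Type*} (a : Γ → X → X) (W : Finset Γ) {k : ℕ}
    (f : X → Fin k) : Set ({γ // γ ∈ W} → Fin k) :=
  {p | ∃ x : X, ∀ γ : {γ // γ ∈ W}, f (a γ.1 x) = p γ}

/-- `a` weakly contains `b`: every `W`-local pattern set of a continuous labelling of `b` is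
realized by a continuous labelling of `a`. -/
def CantorFlow.WeakCont {Γ : Type*} [Group Γ] (a b : CantorFlow Γ) : Prop :=
  ∀ (W : Finset Γ) (k : ℕ) (f : b.X → Fin k), Continuous f →
    ∃ g : a.X → Fin k, Continuous g ∧ labelPattern b.act W f = labelPattern a.act W g

/-- `a` is a free action. -/
def CantorFlow.Free {Γ : Type*} [Group Γ] (a : CantorFlow Γ) : Prop :=
  ∀ (γ : Γ) (x : a.X), a.act γ x = x → γ = 1

/-- `a` is topologically mixing: for all nonempty open `U, V`, `γ·U ∩ V ≠ ∅` for all but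
finitely many `γ`. -/
def CantorFlow.Mixing {Γ : Type*} [Group Γ] (a : CantorFlow Γ) : Prop :=
  ∀ U V : Set a.X, IsOpen U → IsOpen V → U.Nonempty → V.Nonempty →
    {γ : Γ | (a.act γ '' U) ∩ V = ∅}.Finite

theorem nonempty_pi_homeomorph_cantor {ι : Type*} [Countable ι] [Nonempty ι] {X : ι → Type*}
    [∀ i, TopologicalSpace (X i)] (h : ∀ i, Nonempty (X i ≃ₜ (ℕ → Bool))) :
    Nonempty ((∀ i, X i) ≃ₜ (ℕ → Bool)) := by
  obtain ⟨e⟩ : Nonempty (ι × ℕ ≃ ℕ) := nonempty_equiv_of_countable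
  exact ⟨(Homeomorph.piCongrRight fun i => (h i).some).trans
    (Homeomorph.piCurry.symm.trans (Homeomorph.piCongrLeft (Y := fun _ => Bool) e))⟩

theorem nonempty_cantor_sum_homeomorph_cantor :
    Nonempty ((ℕ → Bool) ⊕ (ℕ → Bool) ≃ₜ (ℕ → Bool)) := by
  obtain ⟨e⟩ : Nonempty (Unit ⊕ ℕ ≃ ℕ) := nonempty_equiv_of_countable
  have split : (ℕ → Bool) ≃ₜ Bool × (ℕ → Bool) :=
    ((Homeomorph.piCongrLeft (Y := fun _ => Bool) e).symm.trans
      Homeomorph.sumArrowHomeomorphProdArrow).trans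
      ((Homeomorph.funUnique Unit Bool).prodCongr (Homeomorph.refl _))
  have boolSum : Bool ≃ₜ Unit ⊕ Unit := Equiv.boolEquivPUnitSumPUnit.toHomeomorphOfDiscrete
  exact ⟨((split.trans (boolSum.prodCongr (Homeomorph.refl _))).trans
    (Homeomorph.sumProdDistrib.trans
      ((Homeomorph.punitProd _).sumCongr (Homeomorph.punitProd _)))).symm⟩

theorem nonempty_fin_prod_cantor_homeomorph_cantor (n : ℕ) :
    Nonempty (Fin (n + 1) × (ℕ → Bool) ≃ₜ (ℕ → Bool)) := by
  induction n with
  | zero => exact ⟨Homeomorph.uniqueProd (Fin 1) _⟩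
  | succ n ih =>
    obtain ⟨e⟩ := ih
    obtain ⟨s⟩ := nonempty_cantor_sum_homeomorph_cantor
    have split : Fin (n + 2) ≃ₜ Fin (n + 1) ⊕ Fin 1 :=
      (finSumFinEquiv (m := n + 1) (n := 1)).symm.toHomeomorphOfDiscrete
    exact ⟨((split.prodCongr (Homeomorph.refl _)).trans Homeomorph.sumProdDistrib).trans
      ((e.sumCongr (Homeomorph.uniqueProd _ _)).trans s)⟩

theorem exists_perm_fin_pow_eq_one {m : ℕ} (hm : m ≠ 1) :
    ∃ (n : ℕ) (σ : Equiv.Perm (Fin (n + 1))), σ ^ m = 1 ∧ ∀ i, σ i ≠ i := by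
  have rotate : ∀ k, k + 2 ∣ m → ∃ (n : ℕ) (σ : Equiv.Perm (Fin (n + 1))),
      σ ^ m = 1 ∧ ∀ i, σ i ≠ i := by
    intro k hk
    refine ⟨k + 1, finRotate (k + 2), ?_, fun i => ?_⟩
    · rw [← orderOf_dvd_iff_pow_eq_one, isCycle_finRotate.orderOf, support_finRotate]
      simpa using hk
    · rw [← Equiv.Perm.mem_support, support_finRotate]
      exact Finset.mem_univ i
  match m, hm with
  | 0, _ => exact rotate 0 (dvd_zero _)
  | k + 2, _ => exact rotate k dvd_rfl

/-- A homeomorphism of a Cantor space without fixed points, of order dividing `m`. -/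
theorem exists_cantor_homeomorph_pow_eq_one {m : ℕ} (hm : m ≠ 1) :
    ∃ (D : Type) (_ : TopologicalSpace D) (T : D ≃ₜ D),
      Nonempty (D ≃ₜ (ℕ → Bool)) ∧ T ^ m = 1 ∧ ∀ x, T x ≠ x := by
  obtain ⟨n, σ, hσ, hfix⟩ := exists_perm_fin_pow_eq_one hm
  refine ⟨Fin (n + 1) × (ℕ → Bool), inferInstance,
    σ.toHomeomorphOfDiscrete.prodCongr (Homeomorph.refl _),
    nonempty_fin_prod_cantor_homeomorph_cantor n, ?_, fun x hx => hfix x.1 (congrArg Prod.fst hx)⟩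
  set T : Fin (n + 1) × (ℕ → Bool) ≃ₜ Fin (n + 1) × (ℕ → Bool) :=
    σ.toHomeomorphOfDiscrete.prodCongr (Homeomorph.refl _)
  have hpow : ∀ (j : ℕ) x, (T ^ j) x = ((σ ^ j) x.1, x.2) := by
    intro j
    induction j with
    | zero => intro x; rfl
    | succ j ih =>
      intro x
      rw [pow_succ, pow_succ]
      exact ih (T x)
  ext1 x
  rw [hpow, hσ]
  rfl

namespace CantorFlow

variable {Γ : Type*} [Group Γ]

theorem nonempty_X (a : CantorFlow Γ) : Nonempty a.X :=
  a.cantor.map fun e => e.symm fun _ => false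

/-- The diagonal action on a countable product. -/
def pi {ι : Type} [Countable ι] [Nonempty ι] (a : ι → CantorFlow Γ) : CantorFlow Γ where
  X := ∀ i, (a i).X
  cantor := nonempty_pi_homeomorph_cantor fun i => (a i).cantor
  act γ x i := (a i).act γ (x i)
  act_one x := funext fun i => (a i).act_one (x i)
  act_mul γ δ x := funext fun i => (a i).act_mul γ δ (x i)
  act_cont γ := continuous_pi fun i => ((a i).act_cont γ).comp (continuous_apply i)

theorem labelPattern_pi {ι : Type} [Countable ι] [Nonempty ι] (a : ι → CantorFlow Γ) (i : ι)
    (W : Finset Γ) {k : ℕ} (f : (a i).X → Fin k) :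
    labelPattern (pi a).act W (fun x => f (x i)) = labelPattern (a i).act W f := by
  have := fun i => (a i).nonempty_X
  ext p
  exact ((Function.surjective_eval (β := fun i => (a i).X) i).exists
    (p := fun y => ∀ γ : {γ // γ ∈ W}, f ((a i).act γ.1 y) = p γ)).symm

theorem Mixing.pi {ι : Type} [Countable ι] [Nonempty ι] {a : ι → CantorFlow Γ}
    (h : ∀ i, (a i).Mixing) : (CantorFlow.pi a).Mixing := by
  classical
  rintro U V hU hV ⟨x, hx⟩ ⟨y, hy⟩
  obtain ⟨I, u, hu, hIU⟩ := isOpen_pi_iff.1 hU x hx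
  obtain ⟨J, v, hv, hJV⟩ := isOpen_pi_iff.1 hV y hy
  set u' : ∀ i, Set (a i).X := fun i => if i ∈ I then u i else Set.univ with hu'
  set v' : ∀ i, Set (a i).X := fun i => if i ∈ J then v i else Set.univ with hv'
  have hxu : ∀ i, IsOpen (u' i) ∧ x i ∈ u' i := by
    intro i
    by_cases hi : i ∈ I
    · simpa [hu', hi] using hu i hi
    · simp [hu', hi]
  have hyv : ∀ i, IsOpen (v' i) ∧ y i ∈ v' i := by
    intro i
    by_cases hi : i ∈ J
    · simpa [hv', hi] using hv i hi
    · simp [hv', hi]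
  refine ((I ∪ J).finite_toSet.biUnion fun i _ =>
    h i (u' i) (v' i) (hxu i).1 (hyv i).1 ⟨_, (hxu i).2⟩ ⟨_, (hyv i).2⟩).subset fun γ hγ => ?_
  by_contra hγ'
  simp only [Set.mem_iUnion, Set.mem_ofPred_eq, not_exists] at hγ'
  have hz : ∀ i, ∃ z, i ∈ I ∪ J → z ∈ u' i ∧ (a i).act γ z ∈ v' i := by
    intro i
    by_cases hi : i ∈ I ∪ J
    · obtain ⟨_, ⟨z, hz, rfl⟩, hzv⟩ := Set.nonempty_iff_ne_empty.2 (hγ' i hi)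
      exact ⟨z, fun _ => ⟨hz, hzv⟩⟩
    · exact ⟨x i, fun h => absurd h hi⟩
  choose z hz using hz
  refine Set.Nonempty.ne_empty (s := _ '' U ∩ V) ⟨_, ⟨z, hIU fun i hi => ?_, rfl⟩,
    hJV fun i hi => ?_⟩ hγ
  · have := (hz i (Finset.mem_union_left _ hi)).1
    simpa only [hu', if_pos (Finset.mem_coe.1 hi)] using this
  · have := (hz i (Finset.mem_union_right _ hi)).2
    simp only [hv', if_pos (Finset.mem_coe.1 hi)] at this
    exact this

/-- A nonempty class of flows closed under countable products has an element weakly containing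
all the others. -/
theorem exists_forall_weakCont {Γ : Type} [Group Γ] [Countable Γ] (P : CantorFlow Γ → Prop)
    (hne : ∃ a, P a)
    (hpi : ∀ (ι : Type) [Countable ι] [Nonempty ι] (a : ι → CantorFlow Γ),
      (∀ i, P (a i)) → P (pi a)) :
    ∃ a, P a ∧ ∀ b, P b → a.WeakCont b := by
  let ι := Σ (W : Finset Γ) (k : ℕ), Set ({γ // γ ∈ W} → Fin k)
  have : Nonempty ι := ⟨⟨∅, 0, ∅⟩⟩
  have key : ∀ i : ι, ∃ a, P a ∧ ((∃ b, P b ∧ ∃ f : b.X → Fin i.2.1, Continuous f ∧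
      labelPattern b.act i.1 f = i.2.2) →
      ∃ f : a.X → Fin i.2.1, Continuous f ∧ labelPattern a.act i.1 f = i.2.2) := by
    intro i
    by_cases h : ∃ b, P b ∧ ∃ f : b.X → Fin i.2.1, Continuous f ∧
      labelPattern b.act i.1 f = i.2.2
    · obtain ⟨b, hb, hf⟩ := h
      exact ⟨b, hb, fun _ => hf⟩
    · obtain ⟨a, ha⟩ := hne
      exact ⟨a, ha, fun h' => absurd h' h⟩
  choose a ha hf using key
  refine ⟨pi a, hpi ι a ha, fun b hb W k f hfc => ?_⟩
  obtain ⟨g, hg, hgp⟩ := hf ⟨W, k, labelPattern b.act W f⟩ ⟨b, hb, f, hfc, rfl⟩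
  exact ⟨fun x => g (x _), hg.comp (continuous_apply _),
    hgp.symm.trans (labelPattern_pi a _ W g).symm⟩

/-- The full shift over the Cantor alphabet. -/
def shift (Γ : Type) [Group Γ] [Countable Γ] : CantorFlow Γ where
  X := Γ → ℕ → Bool
  cantor := nonempty_pi_homeomorph_cantor fun _ => ⟨Homeomorph.refl _⟩
  act γ x g := x (g * γ)
  act_one x := by simp
  act_mul γ δ x := by simp [mul_assoc]
  act_cont γ := continuous_pi fun g => continuous_apply (g * γ)

theorem shift_mixing (Γ : Type) [Group Γ] [Countable Γ] : (shift Γ).Mixing := by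
  classical
  rintro U V hU hV ⟨x, hx⟩ ⟨y, hy⟩
  obtain ⟨I, u, hu, hIU⟩ := isOpen_pi_iff.1 hU x hx
  obtain ⟨J, v, hv, hJV⟩ := isOpen_pi_iff.1 hV y hy
  refine (Finset.image₂ (fun g i => g⁻¹ * i) J I).finite_toSet.subset fun γ hγ => ?_
  by_contra hγ'
  refine Set.Nonempty.ne_empty (s := _ '' U ∩ V) ⟨_, ⟨fun t => if t ∈ I then x t else y (t * γ⁻¹),
    hIU fun i hi => ?_, rfl⟩, hJV fun g hg => ?_⟩ hγ
  · beta_reduce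
    rw [if_pos (Finset.mem_coe.1 hi)]
    exact (hu i hi).2
  · have hgI : g * γ ∉ I := fun hgI =>
      hγ' (Finset.mem_coe.2 (Finset.mem_image₂.2 ⟨g, hg, _, hgI, by simp⟩))
    simpa [shift, hgI] using (hv g hg).2

/-- The action coinduced from the action of `zpowers γ` generated by a homeomorphism `T`. -/
def coind {Γ : Type} [Group Γ] [Countable Γ] (γ : Γ) {D : Type} [TopologicalSpace D]
    (hD : Nonempty (D ≃ₜ (ℕ → Bool))) (T : D ≃ₜ D) (hT : T ^ orderOf γ = 1) : CantorFlow Γ where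
  X := {x : Γ → D // ∀ g, x (γ * g) = T (x g)}
  cantor := by
    let r := QuotientGroup.rightRel (Subgroup.zpowers γ)
    have hn : ∀ g : Γ, ∃ n : ℤ, γ ^ n * (Quotient.mk r g).out = g := by
      intro g
      obtain ⟨n, hn⟩ := QuotientGroup.rightRel_apply.1 (Quotient.mk_out (s := r) g)
      exact ⟨n, by rw [show γ ^ n = _ from hn]; simp⟩
    choose n hn using hn
    have hTpow : ∀ i j : ℤ, γ ^ i = γ ^ j → T ^ i = T ^ j := by
      intro i j hij
      rw [← orderOf_dvd_sub_iff_zpow_eq_zpow] at hij ⊢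
      exact (Int.natCast_dvd_natCast.2 (orderOf_dvd_of_pow_eq_one hT)).trans hij
    have hmk : ∀ g, Quotient.mk r (γ * g) = Quotient.mk r g := fun g =>
      Quotient.sound (QuotientGroup.rightRel_apply.2 ⟨-1, by simp⟩)
    have hsucc : ∀ g, T ^ n (γ * g) = T * T ^ n g := by
      intro g
      rw [← zpow_one_add]
      refine hTpow _ _ (mul_right_cancel (b := (Quotient.mk r g).out) ?_)
      rw [zpow_one_add, mul_assoc, hn, ← hmk, hn]
    have hequiv : ∀ x : {x : Γ → D // ∀ g, x (γ * g) = T (x g)}, ∀ (i : ℤ) g,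
        x.1 (γ ^ i * g) = (T ^ i) (x.1 g) := by
      intro x i
      induction i with
      | zero => intro g; simp
      | succ i ih =>
        intro g
        rw [zpow_add_one, zpow_add_one, mul_assoc, ih, x.2]
        rfl
      | pred i ih =>
        intro g
        rw [zpow_sub_one, zpow_sub_one, mul_assoc, ih]
        refine congrArg (T ^ (-(i : ℤ))) (T.injective ?_)
        rw [← x.2, mul_inv_cancel_left]
        exact (T.apply_symm_apply _).symm
    let e : {x : Γ → D // ∀ g, x (γ * g) = T (x g)} ≃ₜ (Quotient r → D) :=
      { toFun := fun x q => x.1 q.out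
        invFun := fun y => ⟨fun g => (T ^ n g) (y (Quotient.mk r g)), fun g => by
          beta_reduce
          rw [hsucc, hmk]
          rfl⟩
        left_inv := fun x => Subtype.ext <| funext fun g => by
          exact (hequiv x (n g) _).symm.trans (congrArg x.1 (hn g))
        right_inv := fun y => funext fun q => by
          have h0 : T ^ n q.out = T ^ (0 : ℤ) := hTpow _ _ <| by
            have := hn q.out
            rw [Quotient.out_eq] at this
            simpa using this
          change (T ^ n q.out) (y (Quotient.mk r q.out)) = y q
          rw [h0, Quotient.out_eq]
          rfl
        continuous_toFun := continuous_pi fun q =>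
          (continuous_apply _).comp continuous_subtype_val
        continuous_invFun := Continuous.subtype_mk (continuous_pi fun g =>
          (T ^ n g).continuous.comp (continuous_apply _)) _ }
    have : Nonempty (Quotient r) := ⟨Quotient.mk r 1⟩
    obtain ⟨c⟩ := nonempty_pi_homeomorph_cantor fun _ : Quotient r => hD
    exact ⟨e.trans c⟩
  act h x := ⟨fun g => x.1 (g * h), fun g => by
    beta_reduce
    rw [mul_assoc, x.2]⟩
  act_one x := by simp
  act_mul h k x := by simp [mul_assoc]
  act_cont h := by
    refine Continuous.subtype_mk (f := fun (x : {x : Γ → D // ∀ g, x (γ * g) = T (x g)}) g =>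
      x.1 (g * h)) (continuous_pi fun g => ?_) _
    exact (continuous_apply (g * h)).comp continuous_subtype_val

theorem exists_free (Γ : Type) [Group Γ] [Countable Γ] : ∃ a : CantorFlow Γ, a.Free := by
  have key : ∀ γ : Γ, ∃ a : CantorFlow Γ, γ ≠ 1 → ∀ x, a.act γ x ≠ x := by
    intro γ
    by_cases hγ : γ = 1
    · exact ⟨shift Γ, fun h => absurd hγ h⟩
    obtain ⟨D, _, T, hD, hT, hfix⟩ :=
      exists_cantor_homeomorph_pow_eq_one (mt orderOf_eq_one_iff.1 hγ)
    refine ⟨coind γ hD T hT, fun _ (x : {x : Γ → D // ∀ g, x (γ * g) = T (x g)}) hx => ?_⟩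
    obtain ⟨x, hxT⟩ := x
    refine hfix (x 1) ?_
    have h1 : x (1 * γ) = x 1 := congrFun (congrArg Subtype.val hx) 1
    exact (hxT 1).symm.trans (((mul_one γ).trans (one_mul γ).symm) ▸ h1)
  choose a ha using key
  refine ⟨pi a, fun γ x hx => ?_⟩
  by_contra hγ
  exact ha γ hγ (x γ) (congrFun hx γ)

end CantorFlow

/-- For a countable group `Γ`: (1) there is a Cantor `Γ`-action weakly containing every
Cantor `Γ`-action; (2) there is a free Cantor `Γ`-action weakly containing every free one;
(3) there is a mixing Cantor `Γ`-action weakly containing every mixing one. -/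
theorem stmt10 (Γ : Type) [Group Γ] [Countable Γ] :
    (∃ a : CantorFlow Γ, ∀ b : CantorFlow Γ, a.WeakCont b) ∧
    (∃ a : CantorFlow Γ, a.Free ∧ ∀ b : CantorFlow Γ, b.Free → a.WeakCont b) ∧
    (∃ a : CantorFlow Γ, a.Mixing ∧ ∀ b : CantorFlow Γ, b.Mixing → a.WeakCont b) := by
  refine ⟨?_, ?_, ?_⟩
  · obtain ⟨a, -, ha⟩ := CantorFlow.exists_forall_weakCont (Γ := Γ) (fun _ => True)
      ⟨CantorFlow.shift Γ, trivial⟩ fun _ _ _ _ _ => trivial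
    exact ⟨a, fun b => ha b trivial⟩
  · refine CantorFlow.exists_forall_weakCont _ (CantorFlow.exists_free Γ) ?_
    intro ι _ hι a ha γ x hx
    exact ha hι.some γ (x _) (congrFun hx _)
  · exact CantorFlow.exists_forall_weakCont _ ⟨_, CantorFlow.shift_mixing Γ⟩
      fun _ _ _ _ ha => CantorFlow.Mixing.pi ha
end

section
/- Let Γ be a countable group containing an element of infinite order (equivalently, containing ℤ as a subgroup). Then there is a set of free actions of Γ on Cantor spaces, of the cardinality of the continuum, that is an antichain under weak containment: no member weakly contains any other member. -/
/-- The node of the tree of `K` below `y` at level `n` has two children. -/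
def Branches (K : Set (ℕ → Bool)) (n : ℕ) (y : ℕ → Bool) : Prop :=
  ∀ b : Bool, ∃ z ∈ K, (∀ i < n, z i = y i) ∧ z n = b

theorem branches_congr {K : Set (ℕ → Bool)} {n : ℕ} {y y' : ℕ → Bool}
    (h : ∀ i < n, y i = y' i) : Branches K n y ↔ Branches K n y' := by
  unfold Branches
  refine forall_congr' fun b => exists_congr fun z => ?_
  refine and_congr_right fun _ => and_congr_left fun _ => ?_
  exact forall₂_congr fun i hi => by rw [h i hi]

theorem branches_of_ne {K : Set (ℕ → Bool)} {n : ℕ} {y y' : ℕ → Bool} (hy : y ∈ K) (hy' : y' ∈ K)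
    (h : ∀ i < n, y i = y' i) (hn : y n ≠ y' n) : Branches K n y := by
  intro b
  by_cases hb : y n = b
  · exact ⟨y, hy, fun _ _ => rfl, hb⟩
  · refine ⟨y', hy', fun i hi => (h i hi).symm, ?_⟩
    revert hn hb
    cases y n <;> cases y' n <;> cases b <;> simp

theorem isClopen_branches {X : Type*} [TopologicalSpace X] {e : X → ℕ → Bool} (he : Continuous e)
    (K : Set (ℕ → Bool)) (n : ℕ) : IsClopen {x | Branches K n (e x)} := by
  have hpre : Continuous fun (x : X) (i : Fin n) => e x i :=
    continuous_pi fun i => (continuous_apply (i : ℕ)).comp he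
  have : {x | Branches K n (e x)} = (fun (x : X) (i : Fin n) => e x i) ⁻¹'
      {s | ∀ b : Bool, ∃ z ∈ K, (∀ i : Fin n, z i = s i) ∧ z n = b} := by
    ext x
    simp [Branches, Fin.forall_iff]
  rw [this]
  exact (isClopen_discrete _).preimage hpre

/-- Prepend a bit to a bit sequence. -/
def consBit (b : Bool) (s : ℕ → Bool) : ℕ → Bool := fun k => Nat.casesOn k b s

theorem continuous_consBit {X : Type*} [TopologicalSpace X] {f : X → Bool} {g : X → ℕ → Bool}
    (hf : Continuous f) (hg : Continuous g) : Continuous fun x => consBit (f x) (g x) := by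
  refine continuous_pi fun k => ?_
  cases k with
  | zero => exact hf
  | succ k => exact (continuous_apply k).comp hg

theorem consBit_inj {b b' : Bool} {s s' : ℕ → Bool} (h : consBit b s = consBit b' s') :
    b = b' ∧ s = s' :=
  ⟨congrFun h 0, funext fun k => congrFun h (k + 1)⟩

theorem consBit_head_tail (s : ℕ → Bool) : consBit (s 0) (fun k => s (k + 1)) = s := by
  funext k
  cases k <;> rfl

open Classical in
/-- At every level, record the next bit of `e x` whenever the tree of the range of `e` branches. -/
noncomputable def mergeBits {X : Type*} (e : X → ℕ → Bool) (x : X × (ℕ → ℕ → Bool)) :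
    ℕ → ℕ → Bool :=
  fun n => if Branches (Set.range e) n (e x.1) then consBit (e x.1 n) (x.2 n) else x.2 n

theorem continuous_mergeBits {X : Type*} [TopologicalSpace X] {e : X → ℕ → Bool}
    (he : Continuous e) : Continuous (mergeBits e) := by
  classical
  refine continuous_pi fun n => ?_
  have hc : Continuous fun x : X × (ℕ → ℕ → Bool) => x.2 n := (continuous_apply n).comp continuous_snd
  have hf : Continuous fun x : X × (ℕ → ℕ → Bool) => e x.1 n :=
    (continuous_apply n).comp (he.comp continuous_fst)
  have hcl : IsClopen {x : X × (ℕ → ℕ → Bool) | Branches (Set.range e) n (e x.1)} :=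
    (isClopen_branches he _ n).preimage continuous_fst
  exact Continuous.if (fun x hx => by simp [hcl.frontier_eq] at hx) (continuous_consBit hf hc) hc

theorem mergeBits_injective {X : Type*} {e : X → ℕ → Bool} (he : Function.Injective e) :
    Function.Injective (mergeBits e) := by
  rintro ⟨x, c⟩ ⟨x', c'⟩ h
  have hn (n : ℕ) := congrFun h n
  simp only [mergeBits] at hn
  have hx : ∀ n, e x n = e x' n := by
    intro n
    induction n using Nat.strong_induction_on with
    | _ n ih =>
      by_contra hne
      have hb := branches_of_ne (Set.mem_range_self x) (Set.mem_range_self x') ih hne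
      have := hn n
      rw [if_pos hb, if_pos ((branches_congr ih).1 hb)] at this
      exact hne (consBit_inj this).1
  obtain rfl := he (funext hx)
  congr 1
  funext n
  have := hn n
  split_ifs at this
  · exact (consBit_inj this).2
  · exact this

theorem mergeBits_surjective {X : Type*} [TopologicalSpace X] [CompactSpace X] [Nonempty X]
    {e : X → ℕ → Bool} (he : Continuous e) : Function.Surjective (mergeBits e) := by
  classical
  intro d
  set S : ℕ → Set X := fun n => {x | ∀ i < n, Branches (Set.range e) i (e x) → e x i = d i 0}
    with hS
  have hne : ∀ n, (S n).Nonempty := by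
    intro n
    induction n with
    | zero => exact ⟨Classical.arbitrary X, by simp [hS]⟩
    | succ n ih =>
      obtain ⟨x, hx⟩ := ih
      by_cases hb : Branches (Set.range e) n (e x)
      · obtain ⟨_, ⟨x', rfl⟩, hpre, hval⟩ := hb (d n 0)
        refine ⟨x', fun i hi hbi => ?_⟩
        rcases Nat.lt_succ_iff_lt_or_eq.1 hi with hi | rfl
        · rw [hpre i hi]
          exact hx i hi ((branches_congr fun j hj => hpre j (hj.trans hi)).1 hbi)
        · exact hval
      · refine ⟨x, fun i hi hbi => ?_⟩
        rcases Nat.lt_succ_iff_lt_or_eq.1 hi with hi | rfl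
        · exact hx i hi hbi
        · exact absurd hbi hb
  have hcl : ∀ n, IsClosed (S n) := by
    intro n
    simp only [hS, Set.ofPred_forall]
    refine isClosed_iInter fun i => isClosed_iInter fun _ => ?_
    simp only [imp_iff_not_or, Set.ofPred_or]
    refine (isClopen_branches he _ i).compl.isClosed.union ?_
    exact isClosed_eq ((continuous_apply i).comp he) continuous_const
  obtain ⟨x, hx⟩ := IsCompact.nonempty_iInter_of_sequence_nonempty_isCompact_isClosed S
    (fun n x hx i hi => hx i (hi.trans n.lt_succ_self)) hne (hcl 0).isCompact hcl
  rw [Set.mem_iInter] at hx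
  refine ⟨(x, fun n => if Branches (Set.range e) n (e x) then fun k => d n (k + 1) else d n), ?_⟩
  funext n
  simp only [mergeBits]
  split_ifs with hb
  · rw [hx (n + 1) n n.lt_succ_self hb, consBit_head_tail]
  · rfl

theorem exists_embedding_cantor (X : Type*) [TopologicalSpace X] [CompactSpace X] [T2Space X]
    [TotallyDisconnectedSpace X] [SecondCountableTopology X] :
    ∃ e : X → ℕ → Bool, Continuous e ∧ Function.Injective e := by
  classical
  have : Countable (TopologicalSpace.Clopens X) :=
    TopologicalSpace.Clopens.countable_iff_secondCountable.2 inferInstance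
  obtain ⟨u, hu⟩ := exists_surjective_nat (TopologicalSpace.Clopens X)
  refine ⟨fun x n => decide (x ∈ u n), continuous_pi fun n => ?_, fun x y h => ?_⟩
  · refine (IsLocallyConstant.iff_continuous _).1 ((IsLocallyConstant.iff_isOpen_fiber).2 ?_)
    intro b
    cases b
    · simpa [Set.preimage, Set.compl_def] using (u n).isClopen.compl.isOpen
    · simpa [Set.preimage] using (u n).isClopen.isOpen
  · by_contra hne
    obtain ⟨U, hU, hx, hy⟩ := exists_isClopen_of_totally_separated hne
    obtain ⟨n, hn⟩ := hu ⟨U, hU⟩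
    have := congrFun h n
    simp only [hn, decide_eq_decide] at this
    exact hy (this.1 hx)

theorem nonempty_homeomorph_prod_cantor (X : Type*) [TopologicalSpace X] [CompactSpace X]
    [T2Space X] [TotallyDisconnectedSpace X] [SecondCountableTopology X] [Nonempty X] :
    Nonempty (X × (ℕ → Bool) ≃ₜ (ℕ → Bool)) := by
  obtain ⟨e, hc, hi⟩ := exists_embedding_cantor X
  have hcont := continuous_mergeBits hc
  let Φ := Equiv.ofBijective (mergeBits e) ⟨mergeBits_injective hi, mergeBits_surjective hc⟩
  let H : X × (ℕ → ℕ → Bool) ≃ₜ (ℕ → ℕ → Bool) :=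
    Continuous.homeoOfEquivCompactToT2 (f := Φ) hcont
  exact ⟨(((Homeomorph.refl X).prodCongr cantorSpaceHomeomorphNatToCantorSpace).trans H).trans
    cantorSpaceHomeomorphNatToCantorSpace.symm⟩

section Periodic

variable {Γ : Type*} [Group Γ] {t : Γ}

theorem zpow_injective_of_not_isOfFinOrder (ht : ¬ IsOfFinOrder t) :
    Function.Injective fun n : ℤ => t ^ n :=
  injective_zpow_iff_not_isOfFinOrder.2 ht

/-- On the double coset of `r` with respect to `⟨t⟩` there is a `ZMod p`-valued labelling, written
in the coordinates `t ^ m * r * t ^ s`, which increases by one under left translation by `t` and is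
invariant under right translation by powers of `t` with exponent divisible by some `p ^ a`. -/
theorem exists_doubleCoset_labelling (ht : ¬ IsOfFinOrder t) (p : ℕ) [Fact p.Prime] (r : Γ) :
    ∃ F : ℤ → ℤ → ZMod p, (∀ m s, F (m + 1) s = F m s + 1) ∧
      (∀ m s m' s', t ^ m * r * t ^ s = t ^ m' * r * t ^ s' → F m s = F m' s') ∧
      ∃ a : ℕ, ∀ m s n : ℤ, (p : ℤ) ^ a ∣ n → F m (s + n) = F m s := by
  have hinj := zpow_injective_of_not_isOfFinOrder ht
  have hp : p.Prime := Fact.out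
  let H : AddSubgroup ℤ :=
    { carrier := {s | ∃ i : ℤ, r * t ^ s = t ^ i * r}
      zero_mem' := ⟨0, by simp⟩
      add_mem' := by
        rintro s s' ⟨i, hi⟩ ⟨i', hi'⟩
        exact ⟨i + i', by rw [zpow_add, ← mul_assoc, hi, mul_assoc, hi', zpow_add, mul_assoc]⟩
      neg_mem' := by
        rintro s ⟨i, hi⟩
        refine ⟨-i, ?_⟩
        rw [zpow_neg, zpow_neg, mul_inv_eq_iff_eq_mul, mul_assoc, hi, inv_mul_cancel_left] }
  obtain ⟨j, hj⟩ := Int.subgroup_cyclic H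
  have key : ∀ {m s m' s' : ℤ}, t ^ m * r * t ^ s = t ^ m' * r * t ^ s' →
      r * t ^ (s - s') = t ^ (m' - m) * r := by
    intro m s m' s' h
    have h1 : r * t ^ s = t ^ (m' - m) * r * t ^ s' := by
      rw [show m' - m = -m + m' by ring, zpow_add, zpow_neg]
      simp only [mul_assoc] at h ⊢
      rw [← h, inv_mul_cancel_left]
    rw [zpow_sub t s, ← mul_assoc, mul_inv_eq_iff_eq_mul, h1]
  by_cases hj0 : j = 0
  · refine ⟨fun m _ => m, fun m s => by push_cast; ring, ?_, 0, fun _ _ _ _ => rfl⟩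
    intro m s m' s' h
    have hk := key h
    have hmem : s - s' ∈ H := ⟨_, hk⟩
    rw [hj, hj0, AddSubgroup.closure_singleton_zero, AddSubgroup.mem_bot] at hmem
    have h0 : s - s' = 0 := hmem
    rw [h0, zpow_zero, mul_one] at hk
    have : m' - m = 0 := hinj (by simpa using hk.symm)
    rw [show m = m' by linarith]
  · obtain ⟨i₀, hi₀⟩ : j ∈ H := by
      rw [hj]; exact AddSubgroup.subset_closure rfl
    have hfin : FiniteMultiplicity (p : ℤ) j :=
      Int.finiteMultiplicity_iff.2 ⟨by simpa using hp.ne_one, hj0⟩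
    obtain ⟨j', hj', hnd⟩ := hfin.exists_eq_pow_mul_and_not_dvd
    set b := multiplicity (p : ℤ) j
    have hj'0 : (j' : ZMod p) ≠ 0 := by
      rwa [Ne, ZMod.intCast_zmod_eq_zero_iff_dvd]
    have hpb : (p : ℤ) ^ b ≠ 0 := pow_ne_zero _ (by exact_mod_cast hp.ne_zero)
    refine ⟨fun m s => m + i₀ / j' * ((s / (p : ℤ) ^ b : ℤ) : ZMod p),
      fun m s => by push_cast; ring, ?_, b + 1, ?_⟩
    · intro m s m' s' h
      have hk := key h
      have hmem : s - s' ∈ H := ⟨_, hk⟩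
      rw [hj, AddSubgroup.mem_closure_singleton] at hmem
      obtain ⟨k, hk'⟩ := hmem
      have hpow : ∀ k : ℤ, r * t ^ (k * j) = t ^ (k * i₀) * r := by
        intro k
        have : r * t ^ j * r⁻¹ = t ^ i₀ := by rw [hi₀]; group
        have h2 := congrArg (· ^ k) this
        simp only [conj_zpow] at h2
        rw [mul_comm k j, mul_comm k i₀, zpow_mul, zpow_mul, ← h2]; group
      rw [← hk', smul_eq_mul, hpow, mul_left_inj] at hk
      have hm : m' = m + k * i₀ := by have := hinj hk; linarith
      have hs : s = s' + (p : ℤ) ^ b * (k * j') := by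
        rw [smul_eq_mul, hj'] at hk'; linear_combination -hk'
      simp only
      rw [hs, hm, Int.add_mul_ediv_left _ _ hpb]
      push_cast
      field_simp
      ring
    · rintro m s _ ⟨l, rfl⟩
      simp only
      rw [show (p : ℤ) ^ (b + 1) * l = (p : ℤ) ^ b * (p * l) by ring, Int.add_mul_ediv_left _ _ hpb]
      push_cast
      simp

/-- The setoid of double cosets of `⟨t⟩`. -/
def zpowDoubleCosetSetoid (t : Γ) : Setoid Γ where
  r g h := ∃ m s : ℤ, h = t ^ m * g * t ^ s
  iseqv :=
    { refl := fun g => ⟨0, 0, by simp⟩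
      symm := by
        rintro g _ ⟨m, s, rfl⟩
        exact ⟨-m, -s, by group⟩
      trans := by
        rintro g _ _ ⟨m, s, rfl⟩ ⟨m', s', rfl⟩
        exact ⟨m' + m, s + s', by simp only [zpow_add, mul_assoc]⟩ }

theorem exists_recurrent_labelling (ht : ¬ IsOfFinOrder t) (p : ℕ) [Fact p.Prime] :
    ∃ φ : Γ → ZMod p, (∀ g, φ (t * g) = φ g + 1) ∧
      ∀ g, ∃ a : ℕ, ∀ n : ℤ, (p : ℤ) ^ a ∣ n → φ (g * t ^ n) = φ g := by
  choose F hF1 hF2 a hF3 using exists_doubleCoset_labelling ht p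
  let S := zpowDoubleCosetSetoid t
  let r : Γ → Γ := fun g => (Quotient.mk S g).out
  have hr : ∀ g, ∃ m s : ℤ, g = t ^ m * r g * t ^ s := fun g => Quotient.mk_out (s := S) g
  have hrr : ∀ g h, S g h → r g = r h := fun g h hgh =>
    congrArg Quotient.out (Quotient.sound (s := S) hgh)
  choose m s hms using hr
  have key : ∀ g (m' s' : ℤ), g = t ^ m' * r g * t ^ s' → F (r g) (m g) (s g) = F (r g) m' s' :=
    fun g m' s' h => hF2 _ _ _ _ _ ((hms g).symm.trans h)
  refine ⟨fun g => F (r g) (m g) (s g), fun g => ?_, fun g => ⟨a (r g), fun n hn => ?_⟩⟩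
  · have h1 : r g = r (t * g) := hrr _ _ ⟨1, 0, by simp⟩
    have h2 := key (t * g) (m g + 1) (s g) (by
      rw [← h1, add_comm, zpow_add, zpow_one, mul_assoc, mul_assoc, ← mul_assoc (t ^ m g), ← hms])
    simp only
    rw [h2, ← h1, hF1]
  · have h1 : r g = r (g * t ^ n) := hrr _ _ ⟨0, n, by simp⟩
    have h2 := key (g * t ^ n) (m g) (s g + n) (by
      rw [← h1, zpow_add, ← mul_assoc, ← hms])
    simp only
    rw [h2, ← h1, hF3 _ _ _ _ hn]

theorem exists_zpow_avoiding (ht : ¬ IsOfFinOrder t) {A : Set Nat.Primes} {q p₀ : Nat.Primes}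
    (hq : q ∉ A) (hp₀ : p₀ ∈ A) (P : Finset Nat.Primes) (a : Nat.Primes → ℕ) (B : Finset Γ) :
    ∃ n : ℕ, ¬ (q : ℕ) ∣ n ∧ t ^ n ∉ B ∧ ∀ p ∈ P, p ∈ A → (p : ℕ) ^ a p ∣ n := by
  classical
  have hcop : ∀ p ∈ A, ∀ k : ℕ, ¬ (q : ℕ) ∣ (p : ℕ) ^ k := fun p hp k hd => hq <| by
    rwa [Subtype.ext ((Nat.prime_dvd_prime_iff_eq q.2 p.2).1 (q.2.dvd_of_dvd_pow hd))]
  set M : ℕ := ∏ p ∈ P.filter (· ∈ A), (p : ℕ) ^ a p with hM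
  have hM0 : M ≠ 0 := Finset.prod_ne_zero_iff.2 fun p _ => pow_ne_zero _ p.2.ne_zero
  have hinj : Function.Injective fun k : ℕ => t ^ (M * (p₀ : ℕ) ^ k) := by
    intro k l h
    have := injective_pow_iff_not_isOfFinOrder.2 ht h
    exact Nat.pow_right_injective p₀.2.two_le (Nat.eq_of_mul_eq_mul_left (Nat.pos_of_ne_zero hM0) this)
  obtain ⟨_, ⟨k, rfl⟩, hk⟩ := (Set.infinite_range_of_injective hinj).exists_notMem_finset B
  refine ⟨M * (p₀ : ℕ) ^ k, fun hd => ?_, hk, fun p hp hpA => ?_⟩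
  · rcases (q.2.dvd_mul).1 hd with hd | hd
    · obtain ⟨p, hp, hd⟩ := (Prime.dvd_finsetProd_iff q.2.prime _).1 hd
      exact hcop p (Finset.mem_filter.1 hp).2 _ hd
    · exact hcop p₀ hp₀ _ hd
  · exact (Finset.dvd_prod_of_mem (fun p : Nat.Primes => (p : ℕ) ^ a p)
      (Finset.mem_filter.2 ⟨hp, hpA⟩)).mul_right _

end Periodic

section Colouring

theorem exists_greedy_colouring {V : Type*} [Countable V] (k : ℕ) (N : V → Finset V)
    (hN : ∀ v, (N v).card ≤ k) (hsymm : ∀ v w, v ∈ N w → w ∈ N v) :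
    ∃ c : V → Fin (k + 1), ∀ v, ∀ w ∈ N v, w ≠ v → c w ≠ c v := by
  classical
  obtain ⟨ι, hι⟩ := Countable.exists_injective_nat V
  have hex : ∀ (v : V) (c : ∀ w, ι w < ι v → Fin (k + 1)), ∃ x : Fin (k + 1),
      ∀ w (h : ι w < ι v), w ∈ N v → c w h ≠ x := by
    intro v c
    let T : Finset (Fin (k + 1)) :=
      (N v).image fun w => if h : ι w < ι v then c w h else 0
    have hT : T.card < (Finset.univ : Finset (Fin (k + 1))).card := by
      rw [Finset.card_univ, Fintype.card_fin]
      exact Nat.lt_succ_of_le (Finset.card_image_le.trans (hN v))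
    obtain ⟨x, -, hx⟩ := Finset.exists_mem_notMem_of_card_lt_card hT
    refine ⟨x, fun w h hw he => hx (Finset.mem_image.2 ⟨w, hw, ?_⟩)⟩
    rw [dif_pos h, he]
  choose pick hpick using hex
  let c : V → Fin (k + 1) := (measure ι).wf.fix pick
  have hc : ∀ v, c v = pick v fun w _ => c w := fun v => (measure ι).wf.fix_eq pick v
  have main : ∀ v w, ι w < ι v → w ∈ N v → c w ≠ c v := fun v w h hw => by
    rw [hc v]
    exact hpick v (fun w _ => c w) w h hw
  refine ⟨c, fun v w hw hne => ?_⟩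
  rcases lt_or_gt_of_ne (hι.ne hne) with h | h
  · exact main v w h hw
  · exact (main w v h (hsymm _ _ hw)).symm

theorem exists_glued_colouring {Γ : Type*} [Group Γ] [Countable Γ] (γ u : Γ) (hγ : γ ≠ 1)
    (E : Finset Γ) (h₁ : ∀ e ∈ E, e * u ∉ E) (h₂ : ∀ e ∈ E, γ * e ≠ e * u)
    (h₃ : ∀ e ∈ E, γ⁻¹ * e ≠ e * u) :
    ∃ c : Γ → Fin 5, (∀ g, c (γ * g) ≠ c g) ∧ ∀ g ∈ E, c (g * u) = c g := by
  classical
  let ρ : Γ → Γ := fun h => if h * u⁻¹ ∈ E then h * u⁻¹ else h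
  have hρ : ∀ h, h = ρ h ∨ h = ρ h * u := by
    intro h
    by_cases hh : h * u⁻¹ ∈ E
    · right; simp [ρ, hh]
    · left; simp [ρ, hh]
  have hρne : ∀ g, ρ (γ * g) ≠ ρ g := by
    intro g h
    by_cases ha : γ * g * u⁻¹ ∈ E <;> by_cases hb : g * u⁻¹ ∈ E <;>
      simp only [ρ, ha, hb, if_true, if_false] at h
    · exact hγ (by simpa using h)
    · rw [h] at ha
      exact h₂ g ha (mul_inv_eq_iff_eq_mul.1 h)
    · rw [← h] at hb
      exact h₃ _ hb (by rw [inv_mul_cancel_left]; rw [h, inv_mul_cancel_right])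
    · exact hγ (by simpa using h)
  let N : Γ → Finset Γ := fun a => {ρ (γ * a), ρ (γ * (a * u)), ρ (γ⁻¹ * a), ρ (γ⁻¹ * (a * u))}
  let N' : Γ → Finset Γ := fun a => (N a).filter fun b => a ∈ N b
  have hadj : ∀ g, ρ (γ * g) ∈ N (ρ g) ∧ ρ g ∈ N (ρ (γ * g)) := by
    intro g
    constructor
    · rcases hρ g with h | h
      · simp [N, ← h]
      · simp [N, ← h]
    · rcases hρ (γ * g) with h | h
      · simp [N, ← h]
      · simp [N, ← h]
  obtain ⟨d, hd⟩ := exists_greedy_colouring 4 N'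
    (fun v => (Finset.card_filter_le _ _).trans Finset.card_le_four)
    (fun v w h => by simp only [N', Finset.mem_filter] at h ⊢; exact h.symm)
  refine ⟨fun g => d (ρ g), fun g => ?_, fun g hg => ?_⟩
  · exact hd _ _ (Finset.mem_filter.2 (hadj g)) (hρne g)
  · have ha : ρ (g * u) = g := by simp [ρ, hg]
    have hb : ρ g = g := by
      have : g * u⁻¹ ∉ E := fun h => h₁ _ h (by simpa using hg)
      simp [ρ, this]
    simp only [ha, hb]

end Colouring

instance Nat.Primes.fact_prime (p : Nat.Primes) : Fact (p : ℕ).Prime := ⟨p.2⟩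

section Flow

variable {Γ : Type} [Group Γ]

/-- Tuples of labellings of `Γ`, one with five colours for each element of `Γ` and one with values
in `ZMod p` for each prime `p`. -/
abbrev Labellings (Γ : Type) : Type :=
  (Γ → Γ → Fin 5) × ((p : Nat.Primes) → Γ → ZMod p)

/-- The shift action of `Γ` on tuples of labellings. -/
def Labellings.shift (δ : Γ) (x : Labellings Γ) : Labellings Γ :=
  (fun γ g => x.1 γ (g * δ), fun p g => x.2 p (g * δ))

theorem Labellings.continuous_shift (δ : Γ) : Continuous (Labellings.shift δ) := by
  unfold Labellings.shift
  fun_prop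

/-- The colouring attached to `γ ≠ 1` is proper for translation by `γ`, and for `p ∈ A` the
labelling attached to `p` increases by one under translation by `t`. -/
def labellingFlow (t : Γ) (A : Set Nat.Primes) : Set (Labellings Γ) :=
  {x | (∀ γ : Γ, γ ≠ 1 → ∀ g, x.1 γ (γ * g) ≠ x.1 γ g) ∧
    ∀ p ∈ A, ∀ g, x.2 p (t * g) = x.2 p g + 1}

theorem isClosed_labellingFlow (t : Γ) (A : Set Nat.Primes) : IsClosed (labellingFlow t A) := by
  have h₁ (γ g : Γ) : IsClosed {x : Labellings Γ | x.1 γ (γ * g) ≠ x.1 γ g} :=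
    (isClosed_discrete {v : Fin 5 × Fin 5 | v.1 ≠ v.2}).preimage
      (f := fun x : Labellings Γ => (x.1 γ (γ * g), x.1 γ g)) (by fun_prop)
  have h₂ (p : Nat.Primes) (g : Γ) : IsClosed {x : Labellings Γ | x.2 p (t * g) = x.2 p g + 1} :=
    (isClosed_discrete {v : ZMod p × ZMod p | v.1 = v.2 + 1}).preimage
      (f := fun x : Labellings Γ => (x.2 p (t * g), x.2 p g)) (by fun_prop)
  have : labellingFlow t A =
      (⋂ γ : Γ, ⋂ _ : γ ≠ 1, ⋂ g, {x : Labellings Γ | x.1 γ (γ * g) ≠ x.1 γ g}) ∩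
      ⋂ p ∈ A, ⋂ g, {x : Labellings Γ | x.2 p (t * g) = x.2 p g + 1} := by
    ext x
    simp [labellingFlow]
  rw [this]
  exact (isClosed_iInter fun γ => isClosed_iInter fun _ => isClosed_iInter fun g => h₁ γ g).inter
    (isClosed_iInter fun p => isClosed_iInter fun _ => isClosed_iInter fun g => h₂ p g)

theorem shift_mem_labellingFlow {t : Γ} {A : Set Nat.Primes} (δ : Γ) {x : Labellings Γ}
    (hx : x ∈ labellingFlow t A) : x.shift δ ∈ labellingFlow t A := by
  refine ⟨fun γ hγ g => ?_, fun p hp g => ?_⟩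
  · simpa only [Labellings.shift, mul_assoc] using hx.1 γ hγ (g * δ)
  · simpa only [Labellings.shift, mul_assoc] using hx.2 p hp (g * δ)

/-- Points of the flow which are invariant under some power of `t`, not divisible by the prime
`q ∉ A`, as far as a given finite window can see. -/
theorem exists_window_periodic [Countable Γ] {t : Γ} (ht : ¬ IsOfFinOrder t)
    {A : Set Nat.Primes} {q p₀ : Nat.Primes} (hq : q ∉ A) (hp₀ : p₀ ∈ A)
    (E : Finset Γ) (P : Finset Nat.Primes) :
    ∃ x ∈ labellingFlow t A, ∃ n : ℕ, ¬ (q : ℕ) ∣ n ∧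
      (∀ γ ∈ E, ∀ g ∈ E, (x.shift (t ^ n)).1 γ g = x.1 γ g) ∧
      ∀ p ∈ P, ∀ g ∈ E, (x.shift (t ^ n)).2 p g = x.2 p g := by
  classical
  choose φ hφ a ha using fun p : Nat.Primes => exists_recurrent_labelling ht (p : ℕ)
  let B : Finset Γ := (E ×ˢ E).image (fun e => e.1⁻¹ * e.2) ∪
    ((E ×ˢ E).image (fun e => e.1⁻¹ * (e.2 * e.1)) ∪
      (E ×ˢ E).image (fun e => e.1⁻¹ * (e.2⁻¹ * e.1)))
  obtain ⟨n, hqn, hB, hn⟩ := exists_zpow_avoiding ht hq hp₀ P (fun p => E.sup (a p)) B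
  simp only [B, Finset.mem_union, not_or] at hB
  have hB' : ∀ f : Γ × Γ → Γ, t ^ n ∉ (E ×ˢ E).image (fun e => e.1⁻¹ * f e) →
      ∀ e ∈ E, ∀ e' ∈ E, f (e, e') ≠ e * t ^ n := fun f hf e he e' he' h => hf <|
    Finset.mem_image.2 ⟨(e, e'), Finset.mem_product.2 ⟨he, he'⟩, inv_mul_eq_iff_eq_mul.2 h⟩
  have hcol : ∀ γ : Γ, ∃ c : Γ → Fin 5, (γ ≠ 1 → ∀ g, c (γ * g) ≠ c g) ∧
      (γ ∈ E → ∀ g ∈ E, c (g * t ^ n) = c g) := by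
    intro γ
    by_cases hγ : γ = 1
    · exact ⟨fun _ => 0, fun h => absurd hγ h, fun _ _ _ => rfl⟩
    by_cases hγE : γ ∈ E
    · obtain ⟨c, hc, hc'⟩ := exists_glued_colouring γ (t ^ n) hγ E
        (fun e he he' => hB' (fun e => e.2) hB.1 e he _ he' rfl)
        (fun e he => hB' (fun e => e.2 * e.1) hB.2.1 e he γ hγE)
        (fun e he => hB' (fun e => e.2⁻¹ * e.1) hB.2.2 e he γ hγE)
      exact ⟨c, fun _ => hc, fun _ => hc'⟩
    · obtain ⟨c, hc, -⟩ := exists_glued_colouring γ (t ^ n) hγ ∅ (by simp) (by simp) (by simp)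
      exact ⟨c, fun _ => hc, fun h => absurd h hγE⟩
  choose c hc using hcol
  refine ⟨(c, fun p => if p ∈ A then φ p else 0), ⟨fun γ => (hc γ).1, fun p hp g => ?_⟩,
    n, hqn, fun γ hγE g hg => (hc γ).2 hγE g hg, fun p hp g hg => ?_⟩
  · simp only [if_pos hp, hφ]
  · by_cases hpA : p ∈ A
    · simp only [Labellings.shift, if_pos hpA, ← zpow_natCast]
      refine ha p g n ?_
      exact_mod_cast (pow_dvd_pow _ (Finset.le_sup hg)).trans (hn p hp hpA)
    · simp [Labellings.shift, hpA]

/-- A prime outside `A` is not detected by the flow. -/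
theorem not_exists_locallyConstant_labelling [Countable Γ] {t : Γ} (ht : ¬ IsOfFinOrder t)
    {A : Set Nat.Primes} {q p₀ : Nat.Primes} (hq : q ∉ A) (hp₀ : p₀ ∈ A)
    (f : labellingFlow t A → ZMod q) (hf : IsLocallyConstant f) :
    ¬ ∀ x : labellingFlow t A, f ⟨_, shift_mem_labellingFlow t x.2⟩ = f x + 1 := by
  classical
  intro hstep
  have hiter : ∀ (n : ℕ) (x : labellingFlow t A),
      f ⟨_, shift_mem_labellingFlow (t ^ n) x.2⟩ = f x + n := by
    intro n
    induction n with
    | zero => intro x; simp [Labellings.shift]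
    | succ n ih =>
      intro x
      have := hstep ⟨_, shift_mem_labellingFlow (t ^ n) x.2⟩
      rw [ih] at this
      rw [Nat.cast_succ, ← add_assoc, ← this]
      simp only [Labellings.shift, pow_succ', mul_assoc]
  choose x hx n hqn hE hP using fun w : Finset Γ × Finset Nat.Primes =>
    exists_window_periodic ht hq hp₀ w.1 w.2
  let y : Finset Γ × Finset Nat.Primes → labellingFlow t A := fun w => ⟨x w, hx w⟩
  let y' : Finset Γ × Finset Nat.Primes → labellingFlow t A := fun w =>
    ⟨_, shift_mem_labellingFlow (t ^ n w) (hx w)⟩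
  have : CompactSpace (labellingFlow t A) :=
    isCompact_iff_compactSpace.1 (isClosed_labellingFlow t A).isCompact
  let V : Ultrafilter (Finset Γ × Finset Nat.Primes) := Ultrafilter.of Filter.atTop
  have hV : (V : Filter (Finset Γ × Finset Nat.Primes)) ≤ Filter.atTop := Ultrafilter.of_le _
  obtain ⟨z, -, hz⟩ := isCompact_univ.ultrafilter_le_nhds (V.map y) (by simp)
  have hy : Filter.Tendsto y V (nhds z) := hz
  have hy' : Filter.Tendsto y' V (nhds z) := by
    have hz' := continuous_subtype_val.continuousAt.tendsto.comp hy
    rw [tendsto_subtype_rng]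
    rw [nhds_prod_eq]
    refine Filter.Tendsto.prodMk (f := V) (m₁ := fun w => (y' w).1.1) (m₂ := fun w => (y' w).1.2)
      (tendsto_pi_nhds.2 fun γ => tendsto_pi_nhds.2 fun g => ?_)
      (tendsto_pi_nhds.2 fun p => tendsto_pi_nhds.2 fun g => ?_)
    · have hcont : Continuous fun x : Labellings Γ => x.1 γ g := by fun_prop
      refine (hcont.continuousAt.tendsto.comp hz').congr' (hV ?_)
      filter_upwards [Filter.eventually_ge_atTop (({γ, g}, ∅) : Finset Γ × Finset Nat.Primes)]
        with w hw
      exact (hE w γ (hw.1 (by simp)) g (hw.1 (by simp))).symm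
    · have hcont : Continuous fun x : Labellings Γ => x.2 p g := by fun_prop
      refine (hcont.continuousAt.tendsto.comp hz').congr' (hV ?_)
      filter_upwards [Filter.eventually_ge_atTop (({g}, {p}) : Finset Γ × Finset Nat.Primes)]
        with w hw
      exact (hP w p (hw.2 (by simp)) g (hw.1 (by simp))).symm
  obtain ⟨w, hw, hw'⟩ := ((hy.eventually (hf.eventually_eq z)).and
    (hy'.eventually (hf.eventually_eq z))).exists
  have hfw : f (y' w) = f (y w) + n w := hiter (n w) (y w)
  rw [hw, hw', left_eq_add, ZMod.natCast_eq_zero_iff] at hfw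
  exact hqn w hfw

/-- The product of `labellingFlow t A` with a trivial action on the Cantor space. -/
def labellingCantorFlow [Countable Γ] (t : Γ) (A : Set Nat.Primes)
    (hne : (labellingFlow t A).Nonempty) : CantorFlow Γ where
  X := labellingFlow t A × (ℕ → Bool)
  cantor :=
    have : CompactSpace (labellingFlow t A) :=
      isCompact_iff_compactSpace.1 (isClosed_labellingFlow t A).isCompact
    have : Nonempty (labellingFlow t A) := hne.to_subtype
    have : Countable Nat.Primes := Subtype.countable
    nonempty_homeomorph_prod_cantor _
  act γ x := (⟨_, shift_mem_labellingFlow γ x.1.2⟩, x.2)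
  act_one x := by simp [Labellings.shift]
  act_mul γ δ x := by simp [Labellings.shift, mul_assoc]
  act_cont γ := by
    have := Labellings.continuous_shift γ
    fun_prop

theorem labellingCantorFlow_free [Countable Γ] {t : Γ} {A : Set Nat.Primes}
    (hne : (labellingFlow t A).Nonempty) : (labellingCantorFlow t A hne).Free := by
  intro γ x hx
  by_contra hγ
  have h₁ := congrArg (fun x : labellingFlow t A × (ℕ → Bool) => x.1.1.1 γ 1) hx
  refine x.1.2.1 γ hγ 1 ?_
  simpa [labellingCantorFlow, Labellings.shift] using h₁

theorem not_weakCont_labellingCantorFlow [Countable Γ] {t : Γ} (ht : ¬ IsOfFinOrder t)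
    {A B : Set Nat.Primes} (hA : A.Nonempty) (hBA : ¬ B ⊆ A)
    (hneA : (labellingFlow t A).Nonempty) (hneB : (labellingFlow t B).Nonempty) :
    ¬ (labellingCantorFlow t A hneA).WeakCont (labellingCantorFlow t B hneB) := by
  classical
  intro hw
  obtain ⟨p₀, hp₀⟩ := hA
  obtain ⟨q, hqB, hqA⟩ := Set.not_subset.1 hBA
  have : NeZero (q : ℕ) := ⟨q.2.ne_zero⟩
  let e := (ZMod.finEquiv (q : ℕ)).symm
  obtain ⟨g, hg, hpat⟩ := hw {1, t} q (fun x => e (x.1.1.2 q 1)) (by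
    have h₁ : Continuous fun x : labellingFlow t B × (ℕ → Bool) => x.1.1.2 q 1 := by fun_prop
    exact continuous_of_discreteTopology.comp h₁)
  have hstep : ∀ x, e.symm (g ((labellingCantorFlow t A hneA).act t x)) = e.symm (g x) + 1 := by
    intro x
    have hmem : (fun γ : {γ // γ ∈ ({1, t} : Finset Γ)} =>
        g ((labellingCantorFlow t A hneA).act γ.1 x)) ∈
        labelPattern (labellingCantorFlow t A hneA).act {1, t} g := ⟨x, fun _ => rfl⟩
    rw [← hpat] at hmem
    obtain ⟨y, hy⟩ := hmem
    have h₁ := hy ⟨1, by simp⟩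
    have h₂ := hy ⟨t, by simp⟩
    simp only [CantorFlow.act_one] at h₁ h₂
    rw [← h₁, ← h₂, e.symm_apply_apply, e.symm_apply_apply]
    simpa [labellingCantorFlow, Labellings.shift] using y.1.2.2 q hqB 1
  refine not_exists_locallyConstant_labelling ht hqA hp₀
    (fun x => e.symm (g (x, fun _ => false))) ?_ fun x => hstep (x, fun _ => false)
  have h₁ : Continuous fun x : labellingFlow t A =>
      g ((x, fun _ => false) : labellingFlow t A × (ℕ → Bool)) := hg.comp (by fun_prop)
  exact (IsLocallyConstant.iff_continuous _).2 (continuous_of_discreteTopology.comp h₁)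

end Flow

/-- An antichain of sets of primes indexed by the sets of natural numbers. -/
def primeCode (S : Set ℕ) : Set Nat.Primes :=
  {p | ∃ n, (n ∈ S ∧ (p : ℕ) = Nat.nth Nat.Prime (2 * n)) ∨
    (n ∉ S ∧ (p : ℕ) = Nat.nth Nat.Prime (2 * n + 1))}

theorem nth_even_mem_primeCode {S : Set ℕ} {n : ℕ} :
    (⟨_, Nat.prime_nth_prime (2 * n)⟩ : Nat.Primes) ∈ primeCode S ↔ n ∈ S := by
  have hinj := Nat.nth_injective Nat.infinite_setOfPred_prime
  constructor
  · rintro ⟨m, ⟨hm, h⟩ | ⟨-, h⟩⟩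
    · have := hinj h
      rwa [show n = m by omega]
    · have := hinj h
      omega
  · exact fun hn => ⟨n, Or.inl ⟨hn, rfl⟩⟩

theorem nth_odd_mem_primeCode {S : Set ℕ} {n : ℕ} :
    (⟨_, Nat.prime_nth_prime (2 * n + 1)⟩ : Nat.Primes) ∈ primeCode S ↔ n ∉ S := by
  have hinj := Nat.nth_injective Nat.infinite_setOfPred_prime
  constructor
  · rintro ⟨m, ⟨-, h⟩ | ⟨hm, h⟩⟩
    · have := hinj h
      omega
    · have := hinj h
      rwa [show n = m by omega]
  · exact fun hn => ⟨n, Or.inr ⟨hn, rfl⟩⟩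

theorem primeCode_nonempty (S : Set ℕ) : (primeCode S).Nonempty := by
  by_cases h : 0 ∈ S
  · exact ⟨_, nth_even_mem_primeCode.2 h⟩
  · exact ⟨_, nth_odd_mem_primeCode.2 h⟩

theorem eq_of_primeCode_subset {S T : Set ℕ} (h : primeCode S ⊆ primeCode T) : S = T := by
  refine Set.Subset.antisymm (fun n hn => ?_) fun n hn => ?_
  · exact nth_even_mem_primeCode.1 (h (nth_even_mem_primeCode.2 hn))
  · by_contra hnS
    exact nth_odd_mem_primeCode.1 (h (nth_odd_mem_primeCode.2 hnS)) hn

theorem labellingFlow_nonempty {Γ : Type} [Group Γ] [Countable Γ] {t : Γ} (ht : ¬ IsOfFinOrder t)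
    (A : Set Nat.Primes) : (labellingFlow t A).Nonempty := by
  classical
  choose φ hφ _ using fun p : Nat.Primes => exists_recurrent_labelling ht (p : ℕ)
  have hcol : ∀ γ : Γ, ∃ c : Γ → Fin 5, γ ≠ 1 → ∀ g, c (γ * g) ≠ c g := by
    intro γ
    by_cases hγ : γ = 1
    · exact ⟨fun _ => 0, fun h => absurd hγ h⟩
    · obtain ⟨c, hc, -⟩ := exists_glued_colouring γ 1 hγ ∅ (by simp) (by simp) (by simp)
      exact ⟨c, fun _ => hc⟩
  choose c hc using hcol
  exact ⟨(c, φ), hc, fun p _ => hφ p⟩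

theorem CantorFlow.WeakCont.refl {Γ : Type*} [Group Γ] (a : CantorFlow Γ) : a.WeakCont a :=
  fun _ _ f hf => ⟨f, hf, rfl⟩

/-- If a countable group `Γ` has an element of infinite order (equivalently, contains `ℤ` as
a subgroup), then there is a continuum-sized antichain of free Cantor `Γ`-actions under weak
containment. -/
theorem stmt17 (Γ : Type) [Group Γ] [Countable Γ]
    (hΓ : ∃ γ : Γ, ¬ IsOfFinOrder γ) :
    ∃ 𝒜 : Set (CantorFlow Γ), Cardinal.mk 𝒜 = Cardinal.continuum ∧
      (∀ a ∈ 𝒜, a.Free) ∧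
      ∀ a ∈ 𝒜, ∀ b ∈ 𝒜, a ≠ b → ¬ a.WeakCont b ∧ ¬ b.WeakCont a := by
  obtain ⟨t, ht⟩ := hΓ
  let F : Set ℕ → CantorFlow Γ := fun S =>
    labellingCantorFlow t (primeCode S) (labellingFlow_nonempty ht _)
  have hF : ∀ S T, S ≠ T → ¬ (F S).WeakCont (F T) := fun S T hST =>
    not_weakCont_labellingCantorFlow ht (primeCode_nonempty S)
      (fun h => hST (eq_of_primeCode_subset h).symm) _ _
  have hinj : Function.Injective F := by
    intro S T h
    by_contra hST
    exact hF S T hST (h ▸ CantorFlow.WeakCont.refl _)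
  refine ⟨Set.range F, ?_, ?_, ?_⟩
  · have := Cardinal.mk_range_eq_of_injective hinj
    rwa [Cardinal.lift_uzero, Cardinal.mk_set_nat, Cardinal.lift_continuum] at this
  · rintro _ ⟨S, rfl⟩
    exact labellingCantorFlow_free _
  · rintro _ ⟨S, rfl⟩ _ ⟨T, rfl⟩ hne
    have hST : S ≠ T := fun h => hne (h ▸ rfl)
    exact ⟨hF S T hST, hF T S hST.symm⟩
end

section
/- There is a set 𝒜 of actions of ℤ² on Cantor spaces, of the cardinality of the continuum, each free and topologically mixing, such that 𝒜 is an antichain under weak containment; moreover, for any two distinct a, b ∈ 𝒜 there is a finite set A and a shift of finite type X ⊆ A^{ℤ²} such that there is a continuous ℤ²-equivariant map from a into X but no continuous ℤ²-equivariant map from b into X. -/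
/-- The left shift action of `ℤ²` on `A^{ℤ²}` (additive notation): `(γ·x)(δ) = x(δ − γ)`. -/
def shift2 {A : Type*} (γ : ℤ × ℤ) (x : ℤ × ℤ → A) : ℤ × ℤ → A :=
  fun δ => x (δ - γ)

/-- A shift of finite type in `A^{ℤ²}`: a nonempty subset cut out by a set of allowed
patterns on a finite window. -/
def IsSFT2 {A : Type*} (Y : Set (ℤ × ℤ → A)) : Prop :=
  Y.Nonempty ∧ ∃ (W : Finset (ℤ × ℤ)) (P : Set ({δ // δ ∈ W} → A)),
    Y = {x | ∀ γ : ℤ × ℤ, (fun w : {δ // δ ∈ W} => shift2 γ x w.1) ∈ P}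

/-- An action of `ℤ²` by homeomorphisms on a Cantor space. -/
structure CantorFlowZ2 where
  X : Type
  [ts : TopologicalSpace X]
  cantor : Nonempty (X ≃ₜ (ℕ → Bool))
  act : ℤ × ℤ → X → X
  act_zero : ∀ x, act 0 x = x
  act_add : ∀ γ δ x, act (γ + δ) x = act γ (act δ x)
  act_cont : ∀ γ, Continuous (act γ)

attribute [instance] CantorFlowZ2.ts

/-- The set of `W`-local patterns of a labelling `f : X → Fin k` with respect to a
`ℤ²`-action. -/
def labelPattern2 {X : Type*} (a : ℤ × ℤ → X → X) (W : Finset (ℤ × ℤ)) {k : ℕ}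
    (f : X → Fin k) : Set ({γ // γ ∈ W} → Fin k) :=
  {p | ∃ x : X, ∀ γ : {γ // γ ∈ W}, f (a γ.1 x) = p γ}

/-- `a` weakly contains `b`. -/
def CantorFlowZ2.WeakCont (a b : CantorFlowZ2) : Prop :=
  ∀ (W : Finset (ℤ × ℤ)) (k : ℕ) (f : b.X → Fin k), Continuous f →
    ∃ g : a.X → Fin k, Continuous g ∧ labelPattern2 b.act W f = labelPattern2 a.act W g

/-- `a` is free. -/
def CantorFlowZ2.Free (a : CantorFlowZ2) : Prop :=
  ∀ (γ : ℤ × ℤ) (x : a.X), a.act γ x = x → γ = 0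

/-- `a` is topologically mixing. -/
def CantorFlowZ2.Mixing (a : CantorFlowZ2) : Prop :=
  ∀ U V : Set a.X, IsOpen U → IsOpen V → U.Nonempty → V.Nonempty →
    {γ : ℤ × ℤ | (a.act γ '' U) ∩ V = ∅}.Finite

/-- `a` admits a continuous equivariant map into the subshift `Y ⊆ A^{ℤ²}`. -/
def CantorFlowZ2.MapsInto (a : CantorFlowZ2) {A : Type*} [TopologicalSpace A]
    (Y : Set (ℤ × ℤ → A)) : Prop :=
  ∃ f : a.X → (ℤ × ℤ → A), Continuous f ∧ (∀ x, f x ∈ Y) ∧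
    ∀ (γ : ℤ × ℤ) (x : a.X), f (a.act γ x) = shift2 γ (f x)

/-- A branch of the binary tree of clopen sets cut out by a splitting rule `V`. -/
def splitBranch {X : Type*} (V : ℕ → Set X → Set X) (b : ℕ → Bool) : ℕ → Set X
  | 0 => Set.univ
  | n + 1 => if b n then splitBranch V b n ∩ V n (splitBranch V b n)
      else splitBranch V b n \ V n (splitBranch V b n)

/-- The cell of level `n` containing `x` in the tree of clopen sets cut out by `V`. -/
def splitCell {X : Type*} (V : ℕ → Set X → Set X) (x : X) : ℕ → Set X
  | 0 => Set.univ
  | n + 1 => {y ∈ splitCell V x n | y ∈ V n (splitCell V x n) ↔ x ∈ V n (splitCell V x n)}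

section Splitting

variable {X : Type*} {V : ℕ → Set X → Set X}

theorem mem_splitCell_self (x : X) (n : ℕ) : x ∈ splitCell V x n := by
  induction n with
  | zero => exact Set.mem_univ _
  | succ n ih => exact ⟨ih, Iff.rfl⟩

theorem splitCell_eq_of_mem {x y : X} {n : ℕ} (h : y ∈ splitCell V x n) :
    splitCell V y n = splitCell V x n := by
  induction n with
  | zero => rfl
  | succ n ih =>
    obtain ⟨h1, h2⟩ := h
    ext z
    simp only [splitCell, ih h1, h2]

theorem splitCell_eq_of_mem_splitBranch {b : ℕ → Bool} {x : X} {n : ℕ}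
    (h : x ∈ splitBranch V b n) : splitCell V x n = splitBranch V b n := by
  induction n with
  | zero => rfl
  | succ n ih =>
    by_cases hb : b n = true
    · simp only [splitBranch, hb, if_true] at h ⊢
      ext z
      simp only [splitCell, ih h.1, Set.mem_ofPred_eq, Set.mem_inter_iff, h.2, iff_true]
    · simp only [splitBranch, hb] at h ⊢
      have h2 : x ∉ V n (splitBranch V b n) := h.2
      ext z
      simp [splitCell, ih h.1, h2]

theorem isClopen_splitCell [TopologicalSpace X] (hV : ∀ n U, IsClopen (V n U))
    (x : X) (n : ℕ) : IsClopen (splitCell V x n) := by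
  induction n with
  | zero => exact isClopen_univ
  | succ n ih =>
    by_cases hx : x ∈ V n (splitCell V x n)
    · have : splitCell V x (n + 1) = splitCell V x n ∩ V n (splitCell V x n) := by
        ext z; simp [splitCell, hx]
      rw [this]
      exact ih.inter (hV n _)
    · have : splitCell V x (n + 1) = splitCell V x n \ V n (splitCell V x n) := by
        ext z; simp [splitCell, hx]
      rw [this]
      exact ih.diff (hV n _)

theorem isClopen_splitBranch [TopologicalSpace X] (hV : ∀ n U, IsClopen (V n U))
    (b : ℕ → Bool) (n : ℕ) : IsClopen (splitBranch V b n) := by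
  induction n with
  | zero => exact isClopen_univ
  | succ n ih =>
    simp only [splitBranch]
    split_ifs
    · exact ih.inter (hV n _)
    · exact ih.diff (hV n _)

end Splitting

/-- Brouwer's characterization of the Cantor space. -/
theorem nonempty_homeomorph_cantor {X : Type*} [TopologicalSpace X] [CompactSpace X]
    [Nonempty X] (C : ℕ → Set X) (hC : ∀ n, IsClopen (C n))
    (hsep : ∀ x y, x ≠ y → ∃ n, x ∈ C n ∧ y ∉ C n)
    (hperf : ∀ x : X, ¬ IsOpen ({x} : Set X)) : Nonempty (X ≃ₜ (ℕ → Bool)) := by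
  classical
  have hsplit : ∀ (n : ℕ) (U : Set X), ∃ V : Set X, IsClopen V ∧
      (IsClopen U → U.Nonempty → (U ∩ V).Nonempty ∧ (U \ V).Nonempty) ∧
      ((U ∩ C n).Nonempty → (U \ C n).Nonempty → V = C n) := by
    intro n U
    by_cases h : (U ∩ C n).Nonempty ∧ (U \ C n).Nonempty
    · exact ⟨C n, hC n, fun _ _ => h, fun _ _ => rfl⟩
    · by_cases hU : IsClopen U ∧ U.Nonempty
      · obtain ⟨hU, x, hx⟩ := hU
        have : ∃ y ∈ U, x ≠ y := by
          by_contra! hcon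
          refine hperf x ?_
          have : U = {x} := Set.eq_singleton_iff_unique_mem.2 ⟨hx, fun y hy => (hcon y hy).symm⟩
          exact this ▸ hU.isOpen
        obtain ⟨y, hy, hxy⟩ := this
        obtain ⟨m, h1, h2⟩ := hsep x y hxy
        exact ⟨C m, hC m, fun _ _ => ⟨⟨x, hx, h1⟩, ⟨y, hy, h2⟩⟩,
          fun h3 h4 => absurd ⟨h3, h4⟩ h⟩
      · exact ⟨∅, isClopen_empty, fun h1 h2 => absurd ⟨h1, h2⟩ hU,
          fun h3 h4 => absurd ⟨h3, h4⟩ h⟩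
  choose V hV hne hVC using hsplit
  let F : X → ℕ → Bool := fun x n => decide (x ∈ V n (splitCell V x n))
  have hcont : Continuous F := by
    refine continuous_pi fun n => ?_
    refine (IsLocallyConstant.iff_exists_open _).2 (fun x => ?_) |>.continuous
    refine ⟨splitCell V x (n + 1), (isClopen_splitCell hV x (n + 1)).isOpen,
      mem_splitCell_self x (n + 1), fun y hy => ?_⟩
    simp only [F, splitCell_eq_of_mem hy.1]
    exact decide_eq_decide.2 hy.2
  have hinj : Function.Injective F := by
    intro x y hxy
    by_contra hne'
    have hcell : ∀ n, splitCell V x n = splitCell V y n := by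
      intro n
      induction n with
      | zero => rfl
      | succ n ih =>
        have := decide_eq_decide.1 (congrFun hxy n)
        rw [ih] at this
        ext z
        simp only [splitCell, ih, this]
    obtain ⟨n, h1, h2⟩ := hsep x y hne'
    have hVn := hVC n (splitCell V x n) ⟨x, mem_splitCell_self x n, h1⟩
      ⟨y, by rw [hcell]; exact mem_splitCell_self y n, h2⟩
    have := decide_eq_decide.1 (congrFun hxy n)
    rw [← hcell n, hVn] at this
    exact h2 (this.1 h1)
  have hsurj : Function.Surjective F := by
    intro b
    have hnon : ∀ n, (splitBranch V b n).Nonempty := by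
      intro n
      induction n with
      | zero => exact Set.univ_nonempty
      | succ n ih =>
        have := hne n _ (isClopen_splitBranch hV b n) ih
        simp only [splitBranch]
        split_ifs
        · exact this.1
        · exact this.2
    obtain ⟨x, hx⟩ := IsCompact.nonempty_iInter_of_sequence_nonempty_isCompact_isClosed
      (splitBranch V b)
      (fun n => by
        simp only [splitBranch]
        split_ifs
        · exact Set.inter_subset_left
        · exact Set.sdiff_subset)
      hnon (isClopen_splitBranch hV b 0).isClosed.isCompact
      (fun n => (isClopen_splitBranch hV b n).isClosed)
    rw [Set.mem_iInter] at hx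
    refine ⟨x, funext fun n => ?_⟩
    have h := hx (n + 1)
    simp only [F, splitCell_eq_of_mem_splitBranch (hx n)]
    simp only [splitBranch] at h
    by_cases hb : b n = true
    · rw [if_pos hb] at h
      simp [hb, h.2]
    · rw [if_neg hb] at h
      have h2 : x ∉ V n (splitBranch V b n) := h.2
      simp [hb, h2]
  exact ⟨hcont.homeoOfEquivCompactToT2 (f := Equiv.ofBijective F ⟨hinj, hsurj⟩)⟩

/-- A subshift over a finite alphabet in which a configuration can be replaced by any other one
on a given finite window, at the cost of modifying it on a larger finite window, and which has
a point with period `per` in each coordinate direction. -/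
structure GluingSubshift where
  A : Type
  [top : TopologicalSpace A]
  [disc : DiscreteTopology A]
  [fin : Finite A]
  carrier : Set (ℤ × ℤ → A)
  isClosed : IsClosed carrier
  shift_mem : ∀ γ, ∀ x ∈ carrier, shift2 γ x ∈ carrier
  glue : ∀ W : Finset (ℤ × ℤ), ∃ D : Finset (ℤ × ℤ), ∀ x ∈ carrier, ∀ y ∈ carrier,
    ∃ z ∈ carrier, (∀ v ∈ W, z v = x v) ∧ ∀ v ∉ D, z v = y v
  per : ℕ
  exists_periodic : ∃ x ∈ carrier, ∀ u v : ℤ × ℤ, x (v + (per : ℤ) • u) = x v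

attribute [instance] GluingSubshift.top GluingSubshift.disc GluingSubshift.fin

namespace GluingSubshift

variable {ι : Type} (Z : ι → GluingSubshift)

/-- The product of a family of subshifts, as a set of functions on `ι × ℤ²`. -/
def prodSet : Set ((p : ι × (ℤ × ℤ)) → (Z p.1).A) :=
  {x | ∀ i, (fun v => x (i, v)) ∈ (Z i).carrier}

variable {Z} in
theorem apply_congr_snd (x : (p : ι × (ℤ × ℤ)) → (Z p.1).A) (i : ι) {v w : ℤ × ℤ} (h : v = w) :
    (x (i, v) : (Z i).A) = x (i, w) := by
  rw [h]

/-- The diagonal shift on the product of a family of subshifts. -/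
def prodAct (γ : ℤ × ℤ) (x : prodSet Z) : prodSet Z :=
  ⟨fun p => x.1 (p.1, p.2 - γ), fun i => (Z i).shift_mem γ _ (x.2 i)⟩

theorem isClosed_prodSet : IsClosed (prodSet Z) := by
  have : prodSet Z = ⋂ i, (fun x : (p : ι × (ℤ × ℤ)) → (Z p.1).A =>
      (fun v => x (i, v) : ℤ × ℤ → (Z i).A)) ⁻¹' (Z i).carrier := by
    ext x
    simp [prodSet]
  rw [this]
  refine isClosed_iInter fun i => (Z i).isClosed.preimage ?_
  exact continuous_pi fun v => continuous_apply ((i, v) : ι × (ℤ × ℤ))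

instance : CompactSpace (prodSet Z) := isCompact_iff_compactSpace.1 (isClosed_prodSet Z).isCompact

theorem continuous_prodAct (γ : ℤ × ℤ) : Continuous (prodAct Z γ) := by
  refine Continuous.subtype_mk (continuous_pi fun p => ?_) _
  exact (continuous_apply ((p.1, p.2 - γ) : ι × (ℤ × ℤ))).comp continuous_subtype_val

theorem prodAct_add (γ δ : ℤ × ℤ) (x : prodSet Z) :
    prodAct Z (γ + δ) x = prodAct Z γ (prodAct Z δ x) := by
  refine Subtype.ext (funext fun p => ?_)
  exact apply_congr_snd x.1 p.1 (by abel : p.2 - (γ + δ) = p.2 - γ - δ)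

theorem prodAct_zero (x : prodSet Z) : prodAct Z 0 x = x := by
  refine Subtype.ext (funext fun p => ?_)
  exact apply_congr_snd x.1 p.1 (sub_zero p.2)

/-- Every neighbourhood in a product of subshifts contains a cylinder. -/
theorem exists_cylinder_subset {U : Set (prodSet Z)} (hU : IsOpen U) {x : prodSet Z}
    (hx : x ∈ U) : ∃ (I : Finset ι) (W : Finset (ℤ × ℤ)), ∀ y : prodSet Z,
      (∀ i ∈ I, ∀ v ∈ W, y.1 (i, v) = x.1 (i, v)) → y ∈ U := by
  classical
  obtain ⟨U', hU', rfl⟩ := isOpen_induced_iff.1 hU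
  obtain ⟨K, u, hu, hsub⟩ := isOpen_pi_iff.1 hU' x.1 hx
  refine ⟨K.image Prod.fst, K.image Prod.snd, fun y hy => hsub fun p hp => ?_⟩
  rw [hy p.1 (Finset.mem_image_of_mem _ hp) p.2 (Finset.mem_image_of_mem _ hp)]
  exact (hu p hp).2

theorem prodAct_mixing {U V : Set (prodSet Z)} (hU : IsOpen U) (hV : IsOpen V)
    (hU' : U.Nonempty) (hV' : V.Nonempty) :
    {γ : ℤ × ℤ | (prodAct Z γ '' U) ∩ V = ∅}.Finite := by
  classical
  obtain ⟨x, hx⟩ := hU'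
  obtain ⟨y, hy⟩ := hV'
  obtain ⟨I, W, hI⟩ := exists_cylinder_subset Z hU hx
  obtain ⟨J, W', hJ⟩ := exists_cylinder_subset Z hV hy
  choose D hD using fun i => (Z i).glue W
  let E : Finset (ℤ × ℤ) := J.biUnion fun i => Finset.image₂ (fun w d => w - d) W' (D i)
  refine E.finite_toSet.subset fun γ hγ => ?_
  by_contra hE
  choose z hz hzx hzy using fun i => hD i _ (x.2 i) _ ((Z i).shift_mem (-γ) _ (y.2 i))
  let z' : prodSet Z := ⟨fun p => z p.1 p.2, hz⟩
  have hzU : z' ∈ U := hI z' fun i _ v hv => hzx i v hv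
  have hzV : prodAct Z γ z' ∈ V := by
    refine hJ _ fun i hi v hv => ?_
    have : v - γ ∉ D i := fun h => hE <| Finset.mem_coe.2 <| Finset.mem_biUnion.2
      ⟨i, hi, Finset.mem_image₂.2 ⟨v, hv, _, h, by abel⟩⟩
    refine (hzy i _ this).trans ?_
    exact apply_congr_snd y.1 i (by abel : v - γ - -γ = v)
  have hγ' : (prodAct Z γ '' U) ∩ V = ∅ := hγ
  exact (hγ' ▸ (⟨⟨z', hzU, rfl⟩, hzV⟩ : prodAct Z γ z' ∈ (prodAct Z γ '' U) ∩ V) :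
    prodAct Z γ z' ∈ (∅ : Set _))

/-- A continuous function to a discrete space on a product of subshifts depends on finitely many
factors only. -/
theorem exists_finset_dependsOn {B : Type*} [TopologicalSpace B] [DiscreteTopology B]
    {G : prodSet Z → B} (hG : Continuous G) :
    ∃ I : Finset ι, ∀ x y : prodSet Z, (∀ i ∈ I, ∀ v, x.1 (i, v) = y.1 (i, v)) → G x = G y := by
  classical
  have hloc : ∀ x : prodSet Z, ∃ U : Set (prodSet Z), IsOpen U ∧ x ∈ U ∧ ∃ I : Finset ι,
      ∀ y ∈ U, ∀ z : prodSet Z, (∀ i ∈ I, ∀ v, z.1 (i, v) = y.1 (i, v)) → G z = G x := by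
    intro x
    obtain ⟨I, W, h⟩ := exists_cylinder_subset Z ((isOpen_discrete {G x}).preimage hG)
      (x := x) rfl
    refine ⟨⋂ i ∈ I, ⋂ v ∈ W, {y | y.1 (i, v) = x.1 (i, v)}, ?_, by simp, I, ?_⟩
    · refine isOpen_biInter_finset fun i _ => isOpen_biInter_finset fun v _ => ?_
      have hc : Continuous fun y : prodSet Z => (y.1 (i, v) : (Z i).A) :=
        (continuous_apply ((i, v) : ι × (ℤ × ℤ))).comp continuous_subtype_val
      exact (isOpen_discrete ({x.1 (i, v)} : Set (Z i).A)).preimage hc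
    · intro y hy z hz
      refine h z fun i hi v hv => (hz i hi v).trans ?_
      simp only [Set.mem_iInter] at hy
      exact hy i hi v hv
  choose U hUo hxU I hI using hloc
  obtain ⟨t, ht⟩ := isCompact_univ.elim_finite_subcover U hUo
    fun x _ => Set.mem_iUnion.2 ⟨x, hxU x⟩
  refine ⟨t.biUnion I, fun x y hxy => ?_⟩
  obtain ⟨w, hw, hy⟩ := Set.mem_iUnion₂.1 (ht (Set.mem_univ y))
  rw [hI w y hy x fun i hi v => hxy i (Finset.mem_biUnion.2 ⟨w, hw, hi⟩) v,
    hI w y hy y fun _ _ _ => rfl]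

instance : Nonempty (prodSet Z) := by
  choose x hx _ using fun i => (Z i).exists_periodic
  exact ⟨⟨fun p => x p.1 p.2, hx⟩⟩

theorem nonempty_prodSet_homeomorph_cantor [Countable ι]
    (hfree : ∀ γ ≠ 0, ∃ i, ∀ x ∈ (Z i).carrier, shift2 γ x ≠ x) :
    Nonempty (prodSet Z ≃ₜ (ℕ → Bool)) := by
  have hι : Nonempty (Σ p : ι × (ℤ × ℤ), (Z p.1).A) := by
    obtain ⟨i, _⟩ := hfree (1, 0) (by simp)
    obtain ⟨x, _⟩ := (Z i).exists_periodic
    exact ⟨⟨(i, 0), x 0⟩⟩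
  obtain ⟨s, hs⟩ := exists_surjective_nat (Σ p : ι × (ℤ × ℤ), (Z p.1).A)
  let T : (Σ p : ι × (ℤ × ℤ), (Z p.1).A) → Set (prodSet Z) := fun q => {x | x.1 q.1 = q.2}
  refine nonempty_homeomorph_cantor (fun n => T (s n))
    (fun n => ?_) (fun x y hxy => ?_) fun x hx => ?_
  · exact (isClopen_discrete {(s n).2}).preimage
      ((continuous_apply (s n).1).comp continuous_subtype_val)
  · obtain ⟨p, hp⟩ := Function.ne_iff.1 fun h => hxy (Subtype.ext h)
    obtain ⟨n, hn⟩ := hs ⟨p, x.1 p⟩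
    exact ⟨n, hn ▸ rfl, hn ▸ hp.symm⟩
  · have hfin := prodAct_mixing Z hx hx ⟨x, rfl⟩ ⟨x, rfl⟩
    obtain ⟨γ, hγ⟩ := (hfin.union (Set.finite_singleton 0)).infinite_compl.nonempty
    simp only [Set.mem_compl_iff, Set.mem_union, not_or] at hγ
    obtain ⟨i, hi⟩ := hfree γ hγ.2
    obtain ⟨_, ⟨y, rfl, rfl⟩, h2⟩ := Set.nonempty_iff_ne_empty.2 hγ.1
    refine hi _ (y.2 i) (funext fun v => ?_)
    exact congrFun (congrArg Subtype.val h2) (i, v)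

/-- The product of a countable jointly free family of gluing subshifts. -/
def prodFlow [Countable ι] (hfree : ∀ γ ≠ 0, ∃ i, ∀ x ∈ (Z i).carrier, shift2 γ x ≠ x) :
    CantorFlowZ2 where
  X := prodSet Z
  cantor := nonempty_prodSet_homeomorph_cantor Z hfree
  act := prodAct Z
  act_zero := prodAct_zero Z
  act_add := prodAct_add Z
  act_cont := continuous_prodAct Z

section

variable [Countable ι] (hfree : ∀ γ ≠ 0, ∃ i, ∀ x ∈ (Z i).carrier, shift2 γ x ≠ x)

theorem prodFlow_free : (prodFlow Z hfree).Free := by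
  intro γ x hx
  by_contra hγ
  obtain ⟨i, hi⟩ := hfree γ hγ
  exact hi _ (x.2 i) (funext fun v => congrFun (congrArg Subtype.val hx) (i, v))

theorem prodFlow_mixing : (prodFlow Z hfree).Mixing :=
  fun _ _ hU hV hU' hV' => prodAct_mixing Z hU hV hU' hV'

/-- Any subshift receiving a map from a product of gluing subshifts has a periodic point whose
period is a product of periods of the factors. -/
theorem exists_periodic_of_mapsInto {B : Type*} [TopologicalSpace B] [DiscreteTopology B]
    {Y : Set (ℤ × ℤ → B)} (h : (prodFlow Z hfree).MapsInto Y) :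
    ∃ (I : Finset ι), ∃ y ∈ Y, ∀ u v : ℤ × ℤ,
      y (v + ((∏ i ∈ I, (Z i).per : ℕ) : ℤ) • u) = y v := by
  obtain ⟨F, hF, hFY, hFe⟩ := h
  have hF0 : Continuous fun x : prodSet Z => F x 0 := (continuous_apply 0).comp hF
  obtain ⟨I, hI⟩ := exists_finset_dependsOn Z hF0
  choose x hx hper using fun i => (Z i).exists_periodic
  let x' : prodSet Z := ⟨fun p => x p.1 p.2, hx⟩
  have key : ∀ v, F x' v = F (prodAct Z (-v) x') 0 := by
    intro v
    have := congrFun (hFe (-v) x') 0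
    simpa [shift2, prodFlow] using this.symm
  refine ⟨I, F x', hFY x', fun u v => ?_⟩
  rw [key, key]
  refine hI _ _ fun i hi w => ?_
  obtain ⟨m, hm⟩ := Finset.dvd_prod_of_mem (fun i => (Z i).per) hi
  simp only [prodAct, x']
  rw [← hper i ((m : ℤ) • u) (w - -v), hm]
  congr 1
  push_cast
  rw [smul_smul]
  abel

end

end GluingSubshift

/-- A weakly containing flow maps into every subshift of finite type into which the contained
flow maps. -/
theorem CantorFlowZ2.WeakCont.mapsInto {a b : CantorFlowZ2} (h : a.WeakCont b) {k : ℕ}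
    {Y : Set (ℤ × ℤ → Fin k)} (hY : IsSFT2 Y) (hb : b.MapsInto Y) : a.MapsInto Y := by
  classical
  obtain ⟨_, W, P, rfl⟩ := hY
  obtain ⟨F, hF, hFY, hFe⟩ := hb
  obtain ⟨g, hg, hpat⟩ := h (W.image fun w => -w) k (fun x => F x 0)
    ((continuous_apply 0).comp hF)
  refine ⟨fun x δ => g (a.act (-δ) x), continuous_pi fun δ => hg.comp (a.act_cont _),
    fun x γ => ?_, fun γ x => funext fun δ => ?_⟩
  · have hmem : (fun w : {δ // δ ∈ W.image fun w => -w} => g (a.act w.1 (a.act γ x))) ∈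
        labelPattern2 a.act (W.image fun w => -w) g := ⟨a.act γ x, fun _ => rfl⟩
    rw [← hpat] at hmem
    obtain ⟨x', hx'⟩ := hmem
    have := hFY x' 0
    convert this using 1
    funext w
    have h1 := hx' ⟨-w.1, Finset.mem_image_of_mem _ w.2⟩
    simp only [hFe, shift2, zero_sub, neg_neg] at h1
    simp only [shift2, sub_zero, h1]
    rw [← a.act_add]
    congr 2
    abel
  · simp only [shift2]
    rw [← a.act_add]
    congr 2
    abel

/-- Every nonzero vector flips some periodic two-coloring of `ℤ²`. -/
theorem exists_periodic_two_coloring {γ : ℤ × ℤ} (hγ : γ ≠ 0) :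
    ∃ (t : ℕ) (c : ℤ × ℤ → Bool), (∀ v, c (v + γ) = !c v) ∧
      ∀ u v, c (v + ((2 ^ t : ℕ) : ℤ) • u) = c v := by
  have main : ∀ a : ℤ, a ≠ 0 → ∃ (t : ℕ) (c : ℤ → Bool), (∀ n, c (n + a) = !c n) ∧
      ∀ m n, c (n + 2 ^ t * m) = c n := by
    intro a ha
    obtain ⟨t, b, hb, rfl⟩ : ∃ (t : ℕ) (b : ℤ), Odd b ∧ a = 2 ^ t * b := by
      obtain ⟨t, b, hb, h⟩ := (Int.finiteMultiplicity_iff.2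
        ⟨by decide, ha⟩ : FiniteMultiplicity (2 : ℤ) a).exists_eq_pow_mul_and_not_dvd
          |> fun ⟨b, h, hb⟩ => (⟨_, b, hb, h⟩ : ∃ t b, ¬ (2 : ℤ) ∣ b ∧ a = 2 ^ t * b)
      exact ⟨t, b, Int.not_even_iff_odd.1 fun h' => hb h'.two_dvd, h⟩
    have h2 : (2 ^ t : ℤ) ≠ 0 := by positivity
    refine ⟨t + 1, fun n => decide (Even (n / 2 ^ t)), fun n => ?_, fun m n => ?_⟩
    · beta_reduce
      rw [Int.add_mul_ediv_left _ _ h2, ← decide_not, decide_eq_decide, Int.even_add]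
      have := Int.not_even_iff_odd.2 hb
      tauto
    · beta_reduce
      rw [pow_succ, mul_assoc, Int.add_mul_ediv_left _ _ h2, decide_eq_decide, Int.even_add]
      simp
  by_cases h1 : γ.1 = 0
  · obtain ⟨t, c, hc, hp⟩ := main γ.2 fun h2 => hγ (Prod.ext h1 h2)
    exact ⟨t, fun v => c v.2, fun v => hc v.2, fun u v => by simpa using hp u.2 v.2⟩
  · obtain ⟨t, c, hc, hp⟩ := main γ.1 h1
    exact ⟨t, fun v => c v.1, fun v => hc v.1, fun u v => by simpa using hp u.1 v.1⟩

/-- Configurations that are proper three-colorings along every coset of `⟨γ⟩`. -/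
def properColorings (γ : ℤ × ℤ) : Set (ℤ × ℤ → Fin 3) :=
  {x | ∀ v, x (v + γ) ≠ x v}

theorem isClosed_properColorings (γ : ℤ × ℤ) : IsClosed (properColorings γ) := by
  have : properColorings γ = ⋂ v, {x | x (v + γ) ≠ x v} := by
    ext x
    simp [properColorings]
  rw [this]
  refine isClosed_iInter fun v => ?_
  have hc : Continuous fun x : ℤ × ℤ → Fin 3 => (x (v + γ), x v) :=
    (continuous_apply (v + γ)).prodMk (continuous_apply v)
  exact (isClosed_discrete {p : Fin 3 × Fin 3 | p.1 ≠ p.2}).preimage hc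

theorem properColorings_glue {γ : ℤ × ℤ} (hγ : γ ≠ 0) (W : Finset (ℤ × ℤ)) :
    ∃ D : Finset (ℤ × ℤ), ∀ x ∈ properColorings γ, ∀ y ∈ properColorings γ,
      ∃ z ∈ properColorings γ, (∀ v ∈ W, z v = x v) ∧ ∀ v ∉ D, z v = y v := by
  classical
  obtain ⟨_, c, hc, -⟩ := exists_periodic_two_coloring hγ
  have hother : ∀ a b : Fin 3, ∃ d, d ≠ a ∧ d ≠ b := by decide
  choose o ho1 ho2 using hother
  let D := W ∪ (W.image (· + γ) ∪ W.image (· - γ))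
  have hD : ∀ v, v + γ ∈ W → v ∈ D := fun v h => by
    refine Finset.mem_union_right _ (Finset.mem_union_right _ ?_)
    exact Finset.mem_image.2 ⟨v + γ, h, by abel⟩
  have hD' : ∀ v, v ∈ W → v + γ ∈ D := fun v h =>
    Finset.mem_union_right _ (Finset.mem_union_left _ (Finset.mem_image_of_mem _ h))
  refine ⟨D, fun x hx y hy => ?_⟩
  let z₀ : ℤ × ℤ → Fin 3 := fun v => if v ∈ W then x v else y v
  let z₁ : ℤ × ℤ → Fin 3 := fun v =>
    if (v ∈ D ∧ v ∉ W) ∧ c v = true then o (z₀ (v + γ)) (z₀ (v - γ)) else z₀ v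
  let z₂ : ℤ × ℤ → Fin 3 := fun v =>
    if (v ∈ D ∧ v ∉ W) ∧ c v = false then o (z₁ (v + γ)) (z₁ (v - γ)) else z₁ v
  refine ⟨z₂, fun v => ?_, fun v hv => ?_, fun v hv => ?_⟩
  · have h1 := hc v
    have h2 := hx v
    have h3 := hy v
    have h4 := hD v
    have h5 := hD' v
    have h6 := ho1 (z₁ (v + γ)) (z₁ (v - γ))
    have h7 := ho1 (z₀ (v + γ)) (z₀ (v - γ))
    have h8 := ho2 (z₁ (v + γ + γ)) (z₁ (v + γ - γ))
    have h9 := ho2 (z₀ (v + γ + γ)) (z₀ (v + γ - γ))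
    rw [add_sub_cancel_right] at h8 h9
    have hz₂ : ∀ u, ¬ ((u ∈ D ∧ u ∉ W) ∧ c u = false) → z₂ u = z₁ u := fun u h => if_neg h
    have hz₁ : ∀ u, ¬ ((u ∈ D ∧ u ∉ W) ∧ c u = true) → z₁ u = z₀ u := fun u h => if_neg h
    have hz₂' : ∀ u, ((u ∈ D ∧ u ∉ W) ∧ c u = false) → z₂ u = o (z₁ (u + γ)) (z₁ (u - γ)) :=
      fun u h => if_pos h
    have hz₁' : ∀ u, ((u ∈ D ∧ u ∉ W) ∧ c u = true) → z₁ u = o (z₀ (u + γ)) (z₀ (u - γ)) :=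
      fun u h => if_pos h
    have hz₀ : ∀ u, u ∈ W → z₀ u = x u := fun u h => if_pos h
    have hz₀' : ∀ u, u ∉ W → z₀ u = y u := fun u h => if_neg h
    have e : v + γ - γ = v := add_sub_cancel_right v γ
    cases hcv : c v <;> simp only [hcv, Bool.not_true, Bool.not_false] at h1 <;> grind
  · simp [z₂, z₁, z₀, hv]
  · have : v ∉ W := fun h => hv (Finset.mem_union_left _ h)
    simp [z₂, z₁, z₀, hv, this]

/-- The gluing subshift of three-colorings that are proper along `γ`. -/
noncomputable def coloringSubshift (γ : ℤ × ℤ) (hγ : γ ≠ 0) : GluingSubshift where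
  A := Fin 3
  carrier := properColorings γ
  isClosed := isClosed_properColorings γ
  shift_mem δ x hx v := by
    simpa [shift2, add_sub_right_comm] using hx (v - δ)
  glue := properColorings_glue hγ
  per := 2 ^ (exists_periodic_two_coloring hγ).choose
  exists_periodic := by
    obtain ⟨c, hc, hper⟩ := (exists_periodic_two_coloring hγ).choose_spec
    refine ⟨fun v => bif c v then 1 else 0, fun v => ?_, fun u v => ?_⟩
    · beta_reduce
      rw [hc]
      cases c v <;> simp
    · beta_reduce
      rw [hper]

/-- The flow on the edges of `ℤ²` modulo `p` with potential `h`, whose divergence is one. -/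
def potentialFlow (p : ℕ) (h : ℤ × ℤ → ZMod p) : ℤ × ℤ → ZMod p × ZMod p :=
  fun v => ((v.1 : ZMod p) + (h v - h (v - (0, 1))), h (v - (1, 0)) - h v)

theorem potentialFlow_div (p : ℕ) (h : ℤ × ℤ → ZMod p) (v : ℤ × ℤ) :
    ((potentialFlow p h v).1 - (potentialFlow p h (v - (1, 0))).1) +
      ((potentialFlow p h v).2 - (potentialFlow p h (v - (0, 1))).2) = 1 := by
  have : v - (1, 0) - (0, 1) = v - (0, 1) - (1, 0) := by abel
  simp only [potentialFlow, Prod.fst_sub, this]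
  push_cast
  ring

/-- The gluing subshift of flows modulo `p` of constant divergence one. -/
def divOneSubshift (p : ℕ) [NeZero p] : GluingSubshift where
  A := ZMod p × ZMod p
  carrier := Set.range (potentialFlow p)
  isClosed := by
    refine (isCompact_range (continuous_pi fun v => ?_)).isClosed
    unfold potentialFlow
    fun_prop
  shift_mem γ x hx := by
    obtain ⟨h, rfl⟩ := hx
    refine ⟨fun v => h (v - γ) - γ.1 * v.2, funext fun v => ?_⟩
    have h1 : ∀ w, v - w - γ = v - γ - w := fun w => by abel
    simp only [shift2, potentialFlow, Prod.fst_sub, Prod.snd_sub, h1]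
    refine Prod.ext ?_ ?_ <;> push_cast <;> ring
  glue W := by
    classical
    let D := W ∪ (W.image (· - (0, 1)) ∪ W.image (· - (1, 0)))
    refine ⟨D ∪ (D.image (· + (0, 1)) ∪ D.image (· + (1, 0))), ?_⟩
    rintro _ ⟨h, rfl⟩ _ ⟨k, rfl⟩
    refine ⟨_, ⟨fun v => if v ∈ D then h v else k v, rfl⟩, fun v hv => ?_, fun v hv => ?_⟩
    · have h1 : v ∈ D := Finset.mem_union_left _ hv
      have h2 : v - (0, 1) ∈ D := Finset.mem_union_right _
        (Finset.mem_union_left _ (Finset.mem_image_of_mem _ hv))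
      have h3 : v - (1, 0) ∈ D := Finset.mem_union_right _
        (Finset.mem_union_right _ (Finset.mem_image_of_mem _ hv))
      simp only [potentialFlow, h1, h2, h3, if_true]
    · have h1 : v ∉ D := fun h => hv (Finset.mem_union_left _ h)
      have h2 : v - (0, 1) ∉ D := fun h => hv (Finset.mem_union_right _
        (Finset.mem_union_left _ (Finset.mem_image.2 ⟨_, h, sub_add_cancel _ _⟩)))
      have h3 : v - (1, 0) ∉ D := fun h => hv (Finset.mem_union_right _
        (Finset.mem_union_right _ (Finset.mem_image.2 ⟨_, h, sub_add_cancel _ _⟩)))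
      simp only [potentialFlow, h1, h2, h3, if_false]
  per := p
  exists_periodic := ⟨_, ⟨fun _ => 0, rfl⟩, fun u v => by simp [potentialFlow]⟩

/-- Configurations which, decoded by `e`, are flows modulo `q` of constant divergence one. -/
def divOneSFT {q k : ℕ} (e : Fin k → ZMod q × ZMod q) : Set (ℤ × ℤ → Fin k) :=
  {x | ∀ v, ((e (x v)).1 - (e (x (v - (1, 0)))).1) +
    ((e (x v)).2 - (e (x (v - (0, 1)))).2) = 1}

theorem isSFT2_divOneSFT {q k : ℕ} (e : Fin k ≃ ZMod q × ZMod q) : IsSFT2 (divOneSFT e) := by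
  classical
  refine ⟨⟨fun v => e.symm (potentialFlow q (fun _ => 0) v), fun v => ?_⟩,
    {0, -(1, 0), -(0, 1)},
    {p | ((e (p ⟨0, by simp⟩)).1 - (e (p ⟨-(1, 0), by simp⟩)).1) +
      ((e (p ⟨0, by simp⟩)).2 - (e (p ⟨-(0, 1), by simp⟩)).2) = 1}, ?_⟩
  · simpa using potentialFlow_div q (fun _ => 0) v
  · ext x
    refine ⟨fun hx γ => ?_, fun hx v => ?_⟩
    · have := hx (-γ)
      have h1 : ∀ w, -w - γ = -γ - w := fun w => by abel
      simpa only [Set.mem_ofPred_eq, shift2, zero_sub, h1] using this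
    · have := hx (-v)
      have h1 : ∀ w, -w - -v = v - w := fun w => by abel
      simpa only [Set.mem_ofPred_eq, shift2, zero_sub, h1, neg_neg] using this

/-- The periods of a flow modulo `q` of constant divergence one have index divisible by `q`. -/
theorem dvd_of_periodic_divOne {q k N : ℕ} {e : Fin k → ZMod q × ZMod q} {x : ℤ × ℤ → Fin k}
    (hx : x ∈ divOneSFT e) (hN : ∀ u v : ℤ × ℤ, x (v + (N : ℤ) • u) = x v) : q ∣ N * N := by
  have tele : ∀ f : ℤ → ZMod q, f N = f 0 →
      ∑ i ∈ Finset.range N, (f ((i : ℤ) + 1) - f i) = 0 := by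
    intro f hf
    have := Finset.sum_range_sub (fun i : ℕ => f i) N
    push_cast at this
    rw [this, hf, sub_self]
  have h1 : ∀ i j : ℕ, ((e (x (i + 1, j + 1))).1 - (e (x (i, j + 1))).1) +
      ((e (x (i + 1, j + 1))).2 - (e (x (i + 1, j))).2) = 1 := by
    intro i j
    simpa using hx (i + 1, j + 1)
  have hsum : ∑ i ∈ Finset.range N, ∑ j ∈ Finset.range N,
      (((e (x (i + 1, j + 1))).1 - (e (x (i, j + 1))).1) +
      ((e (x (i + 1, j + 1))).2 - (e (x (i + 1, j))).2)) = (N * N : ℕ) := by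
    simp [h1]
  rw [← ZMod.natCast_eq_zero_iff, ← hsum]
  simp only [Finset.sum_add_distrib]
  rw [Finset.sum_comm]
  have hA : ∀ j : ℕ, ∑ i ∈ Finset.range N,
      ((e (x (i + 1, j + 1))).1 - (e (x (i, j + 1))).1) = 0 := fun j =>
    tele (fun i => (e (x (i, j + 1))).1) (by
      simpa using congrArg (fun a => (e a).1) (hN (1, 0) (0, j + 1)))
  have hB : ∀ i : ℕ, ∑ j ∈ Finset.range N,
      ((e (x (i + 1, j + 1))).2 - (e (x (i + 1, j))).2) = 0 := fun i =>
    tele (fun j => (e (x (i + 1, j))).2) (by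
      simpa using congrArg (fun a => (e a).2) (hN (0, 1) (i + 1, 0)))
  simp [hA, hB]

theorem exists_injective_odd_primes :
    ∃ P : ℕ × Bool → ℕ, Function.Injective P ∧ ∀ i, (P i).Prime ∧ P i ≠ 2 := by
  have : Infinite {p : ℕ // p.Prime ∧ p ≠ 2} := by
    refine Set.infinite_coe_iff.2 ?_
    exact (Nat.infinite_setOfPred_prime.sdiff (Set.finite_singleton 2))
  refine ⟨fun i => Infinite.natEmbedding {p : ℕ // p.Prime ∧ p ≠ 2} (Encodable.encode i),
    fun i j h => ?_,
    fun i => (Infinite.natEmbedding {p : ℕ // p.Prime ∧ p ≠ 2} (Encodable.encode i)).2⟩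
  exact Encodable.encode_injective ((Infinite.natEmbedding _).injective (Subtype.ext h))

/-- The factors of the flow attached to a sequence of moduli: flows of divergence one for all the
moduli, and colorings ensuring freeness. -/
noncomputable def flowFactor (m : ℕ → ℕ) (hm : ∀ n, (m n).Prime) :
    ℕ ⊕ {γ : ℤ × ℤ // γ ≠ 0} → GluingSubshift
  | Sum.inl n => haveI : NeZero (m n) := ⟨(hm n).ne_zero⟩; divOneSubshift (m n)
  | Sum.inr γ => coloringSubshift γ.1 γ.2

theorem flowFactor_free (m : ℕ → ℕ) (hm : ∀ n, (m n).Prime) :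
    ∀ γ ≠ 0, ∃ i, ∀ x ∈ (flowFactor m hm i).carrier, shift2 γ x ≠ x := by
  intro γ hγ
  refine ⟨Sum.inr ⟨γ, hγ⟩, fun x hx h => hx 0 ?_⟩
  have := congrFun h (0 + γ)
  rw [shift2, add_sub_cancel_right] at this
  exact this.symm

/-- The free mixing flow attached to a sequence of moduli. -/
noncomputable def moduliFlow (m : ℕ → ℕ) (hm : ∀ n, (m n).Prime) : CantorFlowZ2 :=
  GluingSubshift.prodFlow (flowFactor m hm) (flowFactor_free m hm)

theorem moduliFlow_mapsInto (m : ℕ → ℕ) (hm : ∀ n, (m n).Prime) (n : ℕ) {k : ℕ}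
    (e : Fin k ≃ ZMod (m n) × ZMod (m n)) : (moduliFlow m hm).MapsInto (divOneSFT e) := by
  refine ⟨fun x v => e.symm (x.1 (Sum.inl n, v)), continuous_pi fun v => ?_, fun x v => ?_,
    fun γ x => rfl⟩
  · have h1 : Continuous (e.symm : ZMod (m n) × ZMod (m n) → Fin k) :=
      continuous_of_discreteTopology
    refine h1.comp ?_
    exact (continuous_apply ((Sum.inl n, v) : (ℕ ⊕ {γ : ℤ × ℤ // γ ≠ 0}) × (ℤ × ℤ))).comp
      continuous_subtype_val
  · obtain ⟨h, hh⟩ := x.2 (Sum.inl n)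
    have h1 : ∀ v, x.1 (Sum.inl n, v) = potentialFlow (m n) h v := fun v => (congrFun hh v).symm
    simp only [h1, Equiv.apply_symm_apply]
    exact potentialFlow_div (m n) h v

theorem not_moduliFlow_mapsInto (m : ℕ → ℕ) (hm : ∀ n, (m n).Prime) {q k : ℕ} (hq : q.Prime)
    (hq2 : q ≠ 2) (hqm : ∀ n, q ≠ m n) (e : Fin k ≃ ZMod q × ZMod q) :
    ¬ (moduliFlow m hm).MapsInto (divOneSFT e) := by
  intro h
  obtain ⟨I, y, hy, hper⟩ := GluingSubshift.exists_periodic_of_mapsInto _ _ h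
  have hdvd := dvd_of_periodic_divOne hy hper
  rw [hq.dvd_mul, or_self, hq.prime.dvd_finsetProd_iff] at hdvd
  obtain ⟨i, -, hi⟩ := hdvd
  rcases i with n | γ
  · exact hqm n ((Nat.prime_dvd_prime_iff_eq hq (hm n)).1 hi)
  · exact hq2 ((Nat.prime_dvd_prime_iff_eq hq Nat.prime_two).1 (hq.dvd_of_dvd_pow hi))

/-- There is a continuum-sized antichain of free, topologically mixing `ℤ²`-actions on
Cantor spaces; moreover any two distinct members are separated by a shift of finite type
(one maps into it, the other admits no map into it). -/
theorem stmt19 :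
    ∃ 𝒜 : Set CantorFlowZ2, Cardinal.mk 𝒜 = Cardinal.continuum ∧
      (∀ a ∈ 𝒜, a.Free ∧ a.Mixing) ∧
      (∀ a ∈ 𝒜, ∀ b ∈ 𝒜, a ≠ b → ¬ a.WeakCont b ∧ ¬ b.WeakCont a) ∧
      ∀ a ∈ 𝒜, ∀ b ∈ 𝒜, a ≠ b →
        ∃ (k : ℕ) (Y : Set (ℤ × ℤ → Fin k)), IsSFT2 Y ∧
          a.MapsInto Y ∧ ¬ b.MapsInto Y := by
  obtain ⟨P, hP, hPp⟩ := exists_injective_odd_primes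
  let F : (ℕ → Bool) → CantorFlowZ2 := fun f =>
    moduliFlow (fun n => P (n, f n)) fun n => (hPp (n, f n)).1
  have hsep : ∀ f g, f ≠ g → ∃ (k : ℕ) (Y : Set (ℤ × ℤ → Fin k)), IsSFT2 Y ∧
      (F f).MapsInto Y ∧ ¬ (F g).MapsInto Y := by
    intro f g hfg
    obtain ⟨n, hn⟩ := Function.ne_iff.1 hfg
    have : NeZero (P (n, f n)) := ⟨(hPp (n, f n)).1.ne_zero⟩
    let e := (Fintype.equivFin (ZMod (P (n, f n)) × ZMod (P (n, f n)))).symm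
    refine ⟨_, divOneSFT e, isSFT2_divOneSFT e, moduliFlow_mapsInto (fun n => P (n, f n)) _ n e,
      not_moduliFlow_mapsInto _ _ (hPp (n, f n)).1 (hPp (n, f n)).2 (fun n' h => hn ?_) e⟩
    obtain ⟨rfl, h⟩ := Prod.ext_iff.1 (hP h)
    exact h
  have hinj : Function.Injective F := by
    intro f g hfg
    by_contra hne
    obtain ⟨_, _, _, h1, h2⟩ := hsep f g hne
    exact h2 (hfg ▸ h1)
  refine ⟨Set.range F, ?_, ?_, ?_, ?_⟩
  · simpa using Cardinal.mk_range_eq_of_injective hinj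
  · rintro _ ⟨f, rfl⟩
    exact ⟨GluingSubshift.prodFlow_free _ _, GluingSubshift.prodFlow_mixing _ _⟩
  · rintro _ ⟨f, rfl⟩ _ ⟨g, rfl⟩ hfg
    refine ⟨fun h => ?_, fun h => ?_⟩
    · obtain ⟨_, _, hY, h1, h2⟩ := hsep g f fun h => hfg (h ▸ rfl)
      exact h2 (h.mapsInto hY h1)
    · obtain ⟨_, _, hY, h1, h2⟩ := hsep f g fun h => hfg (h ▸ rfl)
      exact h2 (h.mapsInto hY h1)
  · rintro _ ⟨f, rfl⟩ _ ⟨g, rfl⟩ hfg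
    exact hsep f g fun h => hfg (h ▸ rfl)
end
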